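/- arXiv:2111.10298 — 3 statements merged into one kernel-verified Lean document; each statement's English description precedes it below -/
import Mathlib

section
/- Let f : ℝ^d → ℝ satisfy the standing assumptions. Fix a starting point x lying in the basin of attraction of a mode x_* of f, and fix a level step η > 0. Define levels t_0 = f(x) and t_k = t_0 + kη, and a sequence q_0 = x and, for k ≥ 1, q_k a metric projection of q_{k−1} onto the level set L_{t_k}; the construction stops (returning the maximizer of f over the connected component of U_{t_{k−1}} containing q_{k−1}) as soon as q_k leaves that connected component or L_{t_k} is empty. Then, for all sufficiently small η > 0, this procedure (Algorithm 1) terminates and returns the mode x_*. -/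
open Metric Set Filter Topology MeasureTheory

noncomputable section

variable {d : ℕ}

/-- Standing assumptions on the density `f`: twice continuously differentiable with bounded
values, gradient and Hessian; vanishing at infinity; Morse (non-degenerate critical points). -/
def StandingAssumptions (f : EuclideanSpace ℝ (Fin d) → ℝ) : Prop :=
  ContDiff ℝ 2 f ∧
  (∃ M, ∀ x, |f x| ≤ M) ∧
  (∃ M, ∀ x, ‖gradient f x‖ ≤ M) ∧
  (∃ M, ∀ x, ‖fderiv ℝ (gradient f) x‖ ≤ M) ∧
  Tendsto f (cocompact (EuclideanSpace ℝ (Fin d))) (nhds 0) ∧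
  (∀ x, gradient f x = 0 → Function.Bijective (fderiv ℝ (gradient f) x))

/-- `γ` is the gradient flow line of `f` starting at `x`. -/
def IsGradientFlow (f : EuclideanSpace ℝ (Fin d) → ℝ) (x : EuclideanSpace ℝ (Fin d))
    (γ : ℝ → EuclideanSpace ℝ (Fin d)) : Prop :=
  γ 0 = x ∧ ∀ t : ℝ, 0 ≤ t → HasDerivAt γ (gradient f (γ t)) t

/-- `x` lies in the basin of attraction of `x₀` for the gradient flow of `f`. -/
def InBasin (f : EuclideanSpace ℝ (Fin d) → ℝ) (x₀ x : EuclideanSpace ℝ (Fin d)) : Prop :=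
  ∃ γ : ℝ → EuclideanSpace ℝ (Fin d), IsGradientFlow f x γ ∧ Tendsto γ atTop (nhds x₀)

/-- `p` is a metric projection of `y` onto the set `A`. -/
def IsProjOn (A : Set (EuclideanSpace ℝ (Fin d))) (y p : EuclideanSpace ℝ (Fin d)) : Prop :=
  p ∈ A ∧ dist y p = infDist y A

/-- A complete run of Algorithm 1 with level step `η`, starting point `x`:
`q 0 = x`; for each step `k < K` the point `q (k+1)` is a metric projection of `q k` onto the
level set at level `f x + (k+1)·η` and it stays in the connected component of the upper level
set at level `f x + k·η` containing `q k`; at step `K` the stopping rule triggers (the next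
level set is empty, or a projection leaves the current connected component); and `r` is a
maximizer of `f` over the current connected component (the returned point). -/
def Alg1Run (f : EuclideanSpace ℝ (Fin d) → ℝ) (x : EuclideanSpace ℝ (Fin d)) (η : ℝ)
    (q : ℕ → EuclideanSpace ℝ (Fin d)) (K : ℕ) (r : EuclideanSpace ℝ (Fin d)) : Prop :=
  q 0 = x ∧
  (∀ k < K,
    IsProjOn {y | f y = f x + ((k : ℝ) + 1) * η} (q k) (q (k + 1)) ∧
    q (k + 1) ∈ connectedComponentIn {y | f x + (k : ℝ) * η ≤ f y} (q k)) ∧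
  ({y | f y = f x + ((K : ℝ) + 1) * η} = ∅ ∨
    ∃ p, IsProjOn {y | f y = f x + ((K : ℝ) + 1) * η} (q K) p ∧
      p ∉ connectedComponentIn {y | f x + (K : ℝ) * η ≤ f y} (q K)) ∧
  r ∈ connectedComponentIn {y | f x + (K : ℝ) * η ≤ f y} (q K) ∧
  ∀ y ∈ connectedComponentIn {y | f x + (K : ℝ) * η ≤ f y} (q K), f y ≤ f r

section GradientEstimates

variable {F : Type*} [NormedAddCommGroup F] [InnerProductSpace ℝ F] [CompleteSpace F]
  {f : F → ℝ} {L G : ℝ}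

open scoped RealInnerProductSpace

/-- First-order Taylor estimate for a function with Lipschitz gradient. -/
lemma abs_sub_sub_inner_gradient_le (hf : Differentiable ℝ f) (hL0 : 0 ≤ L)
    (hL : ∀ y z, ‖gradient f y - gradient f z‖ ≤ L * ‖y - z‖) (y v : F) :
    |f (y + v) - f y - ⟪gradient f y, v⟫| ≤ L * ‖v‖ ^ 2 := by
  have key := Convex.norm_image_sub_le_of_norm_hasFDerivWithin_le' (𝕜 := ℝ) (f := f)
    (f' := fun z => InnerProductSpace.toDual ℝ F (gradient f z))
    (φ := InnerProductSpace.toDual ℝ F (gradient f y)) (C := L * ‖v‖)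
    (s := closedBall y ‖v‖) (x := y) (y := y + v)
    (fun z _ => (hf z).hasGradientAt.hasFDerivAt.hasFDerivWithinAt)
    (fun z hz => by
      rw [← map_sub, LinearIsometryEquiv.norm_map]
      refine (hL z y).trans ?_
      gcongr
      simpa [dist_eq_norm] using hz)
    (convex_closedBall _ _) (by simp) (by simp)
  simpa [Real.norm_eq_abs, pow_two, mul_assoc] using key

lemma add_mul_norm_gradient_sq_le (hf : Differentiable ℝ f) (hL0 : 0 ≤ L)
    (hL : ∀ y z, ‖gradient f y - gradient f z‖ ≤ L * ‖y - z‖) (y : F) (a : ℝ) :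
    f y + (a - L * a ^ 2) * ‖gradient f y‖ ^ 2 ≤ f (y + a • gradient f y) := by
  have h := (abs_le.mp (abs_sub_sub_inner_gradient_le hf hL0 hL y (a • gradient f y))).1
  rw [inner_smul_right, real_inner_self_eq_norm_sq, norm_smul, mul_pow, Real.norm_eq_abs,
    sq_abs] at h
  linarith

/-- A maximizer of `f` over a connected component of an upper level set is a critical point. -/
lemma gradient_eq_zero_of_isMax_connectedComponentIn (hf : Differentiable ℝ f) (hL0 : 0 < L)
    (hL : ∀ y z, ‖gradient f y - gradient f z‖ ≤ L * ‖y - z‖) {t : ℝ} {y r : F}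
    (hr : r ∈ connectedComponentIn {z | t ≤ f z} y)
    (hmax : ∀ z ∈ connectedComponentIn {z | t ≤ f z} y, f z ≤ f r) : gradient f r = 0 := by
  by_contra hg
  have hg' : 0 < ‖gradient f r‖ ^ 2 := by positivity
  have hasc : ∀ a ∈ Icc (0 : ℝ) (1 / (2 * L)),
      f r + a / 2 * ‖gradient f r‖ ^ 2 ≤ f (r + a • gradient f r) := fun a ha => by
    refine le_trans ?_ (add_mul_norm_gradient_sq_le hf hL0.le hL r a)
    have h1 : L * a ≤ 1 / 2 := by
      have := mul_le_mul_of_nonneg_left ha.2 hL0.le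
      field_simp at this ⊢
      linarith
    have : a / 2 ≤ a - L * a ^ 2 := by nlinarith [ha.1]
    gcongr
  have hrt : t ≤ f r := connectedComponentIn_subset {z | t ≤ f z} y hr
  set S := (fun a : ℝ => r + a • gradient f r) '' Icc (0 : ℝ) (1 / (2 * L)) with hS
  have h0 : (0 : ℝ) ∈ Icc (0 : ℝ) (1 / (2 * L)) := ⟨le_rfl, by positivity⟩
  have hSpre : IsPreconnected S := isPreconnected_Icc.image _ (by fun_prop)
  have hSsub : S ⊆ connectedComponentIn {z | t ≤ f z} y := by
    rw [connectedComponentIn_eq hr]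
    refine hSpre.subset_connectedComponentIn ⟨0, h0, by simp⟩ ?_
    rintro _ ⟨a, ha, rfl⟩
    have := hasc a ha
    have h2 : 0 ≤ a / 2 * ‖gradient f r‖ ^ 2 := mul_nonneg (by linarith [ha.1]) hg'.le
    change t ≤ f _
    linarith
  have hend : 1 / (2 * L) ∈ Icc (0 : ℝ) (1 / (2 * L)) := ⟨by positivity, le_rfl⟩
  have h1 := hmax _ (hSsub ⟨_, hend, rfl⟩)
  have h2 := hasc _ hend
  have h3 : 0 < 1 / (2 * L) / 2 * ‖gradient f r‖ ^ 2 := by positivity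
  simp only at h1
  linarith

/-- A nearest point of a level set differs from the projected point by a multiple of the
gradient. -/
lemma exists_sub_eq_smul_gradient (hf : ContDiff ℝ 1 f) {q p : F}
    (hg : gradient f p ≠ 0) (hp : ∀ z, f z = f p → dist q p ≤ dist q z) :
    ∃ h : ℝ, p - q = h • gradient f p := by
  have hmin : IsLocalExtrOn (fun z => ‖z - q‖ ^ 2) {z | f z = f p} p := by
    refine Or.inl (eventually_nhdsWithin_of_forall fun z hz => ?_)
    have := hp z hz
    rw [dist_comm q p, dist_comm q z, dist_eq_norm, dist_eq_norm] at this
    exact pow_le_pow_left₀ (norm_nonneg _) this 2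
  have hsf : HasStrictFDerivAt f (InnerProductSpace.toDual ℝ F (gradient f p)) p := by
    have := hf.contDiffAt.hasStrictFDerivAt (x := p) one_ne_zero
    simpa using this
  have hsn := (hasStrictFDerivAt_norm_sq (p - q)).comp p
    ((hasStrictFDerivAt_id (𝕜 := ℝ) p).sub_const q)
  obtain ⟨a, b, hab, h⟩ := hmin.exists_multipliers_of_hasStrictFDerivAt_1d hsf hsn
  have hv : a • gradient f p + (2 * b) • (p - q) = 0 := by
    refine ext_inner_right ℝ fun v => ?_
    have := DFunLike.congr_fun h v
    simp at this
    rw [inner_add_left, real_inner_smul_left, real_inner_smul_left, inner_zero_left,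
      inner_gradient_left, inner_sub_left]
    linarith
  have hb : b ≠ 0 := by
    rintro rfl
    simp only [mul_zero, zero_smul, add_zero, smul_eq_zero, hg, or_false] at hv
    exact hab (by simp [hv])
  refine ⟨-(a / (2 * b)), ?_⟩
  have h2 : (2 * b) • (p - q) = (2 * b) • (-(a / (2 * b)) • gradient f p) := by
    rw [smul_smul, eq_neg_of_add_eq_zero_right hv, ← neg_smul]
    congr 1
    field_simp
  exact smul_right_injective F (mul_ne_zero two_ne_zero hb) h2

/-- If the gradient at `q` is not too small, any slightly higher level set contains a point
near `q`. -/
lemma exists_level_dist_le (hf : Differentiable ℝ f) (hL0 : 0 < L)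
    (hL : ∀ y z, ‖gradient f y - gradient f z‖ ≤ L * ‖y - z‖)
    (hG : ∀ y, ‖gradient f y‖ ≤ G) {c η : ℝ} (hc : 0 < c) (hη : 0 < η)
    (hsmall : 8 * G * L * η ≤ c ^ 3) {q : F} (hq : c ≤ ‖gradient f q‖) :
    ∃ z, f z = f q + η ∧ dist q z ≤ 2 * G * η / c ^ 2 := by
  have hcG : c ≤ G := hq.trans (hG q)
  have hsmall' : 4 * L * η ≤ c ^ 2 := by
    have h1 : c * (8 * L * η) ≤ G * (8 * L * η) := by gcongr
    have h2 : c * (8 * L * η) ≤ c * c ^ 2 := by nlinarith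
    have := le_of_mul_le_mul_left h2 hc
    nlinarith [mul_pos hL0 hη]
  set τ := 2 * η / c ^ 2 with hτ
  have hτ0 : 0 ≤ τ := by positivity
  have hLτ : L * τ ≤ 1 / 2 := by
    rw [hτ, ← mul_div_assoc, div_le_iff₀ (by positivity)]
    linarith
  have hup : f q + η ≤ f (q + τ • gradient f q) := by
    refine le_trans ?_ (add_mul_norm_gradient_sq_le hf hL0.le hL q τ)
    have h1 : τ / 2 ≤ τ - L * τ ^ 2 := by nlinarith
    have h2 : c ^ 2 ≤ ‖gradient f q‖ ^ 2 := by gcongr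
    have h3 : η = τ / 2 * c ^ 2 := by rw [hτ]; field_simp
    have h4 : τ / 2 * c ^ 2 ≤ (τ - L * τ ^ 2) * ‖gradient f q‖ ^ 2 := by
      gcongr
      exact le_trans (by positivity) h1
    linarith
  have hcont : ContinuousOn (fun a : ℝ => f (q + a • gradient f q)) (Icc 0 τ) :=
    (hf.continuous.comp (by fun_prop)).continuousOn
  obtain ⟨a, ha, hfa⟩ := intermediate_value_Icc hτ0 hcont
    (show f q + η ∈ Icc _ _ from ⟨by simp [hη.le], hup⟩)
  refine ⟨_, hfa, ?_⟩
  rw [dist_self_add_right, norm_smul, Real.norm_of_nonneg ha.1]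
  calc a * ‖gradient f q‖ ≤ τ * G := by gcongr; exacts [ha.2, hG q]
    _ = 2 * G * η / c ^ 2 := by rw [hτ]; ring

/-- A nearest point `p` of `q` on a slightly higher level set is an implicit Euler step of the
gradient flow, and the segment between `q` and `p` stays in the upper level set of `q`. -/
lemma exists_implicit_euler_step (hf : ContDiff ℝ 1 f) (hL0 : 0 < L)
    (hL : ∀ y z, ‖gradient f y - gradient f z‖ ≤ L * ‖y - z‖)
    (hG : ∀ y, ‖gradient f y‖ ≤ G) {c η : ℝ} (hc : 0 < c) (hη : 0 < η)
    (hsmall : 8 * G * L * η ≤ c ^ 3) {q p : F} (hq : c ≤ ‖gradient f q‖)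
    (hfp : f p = f q + η) (hp : ∀ z, f z = f q + η → dist q p ≤ dist q z) :
    ∃ h : ℝ, 0 ≤ h ∧ h ≤ 4 * G / c ^ 3 * η ∧ p = q + h • gradient f p ∧
      p ∈ connectedComponentIn {z | f q ≤ f z} q := by
  have hd := hf.differentiable one_ne_zero
  have hG0 : 0 < G := (hc.trans_le hq).trans_le (hG q)
  obtain ⟨z, hz, hqz⟩ := exists_level_dist_le hd hL0 hL hG hc hη hsmall hq
  have hpq : ‖p - q‖ ≤ 2 * G * η / c ^ 2 := by
    rw [← dist_eq_norm, dist_comm]; exact (hp z hz).trans hqz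
  have hgp : c / 2 ≤ ‖gradient f p‖ := by
    have h1 := hL q p
    have h2 := norm_sub_norm_le (gradient f q) (gradient f p)
    have h3 : L * ‖q - p‖ ≤ c / 2 := by
      rw [norm_sub_rev]
      calc L * ‖p - q‖ ≤ L * (2 * G * η / c ^ 2) := by gcongr
        _ ≤ c / 2 := by
          rw [← mul_div_assoc, div_le_iff₀ (by positivity)]; nlinarith
    linarith
  have hgp0 : gradient f p ≠ 0 := norm_pos_iff.mp (by linarith)
  obtain ⟨h, hh⟩ := exists_sub_eq_smul_gradient hf hgp0 (q := q)
    (fun z hz => hp z (hz.trans hfp))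
  have habs : |h| ≤ 4 * G / c ^ 3 * η := by
    rw [hh, norm_smul, Real.norm_eq_abs] at hpq
    have h1 : |h| * (c / 2) ≤ 2 * G * η / c ^ 2 :=
      (mul_le_mul_of_nonneg_left hgp (abs_nonneg h)).trans hpq
    calc |h| = |h| * (c / 2) * (2 / c) := by field_simp
      _ ≤ 2 * G * η / c ^ 2 * (2 / c) := by gcongr
      _ = _ := by field_simp; ring
  have hLh : L * |h| ≤ 1 / 2 := by
    calc L * |h| ≤ L * (4 * G / c ^ 3 * η) := by gcongr
      _ = (8 * G * L * η) / c ^ 3 / 2 := by ring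
      _ ≤ 1 / 2 := by
        gcongr
        rw [div_le_one (by positivity)]; exact hsmall
  have hqp : q = p + (-h) • gradient f p := by rw [neg_smul, ← hh]; abel
  have hh0 : 0 ≤ h := by
    by_contra! hneg
    have h1 := add_mul_norm_gradient_sq_le hd hL0.le hL p (-h)
    rw [← hqp] at h1
    rw [abs_of_neg hneg] at hLh
    have h2 : 0 ≤ -h - L * (-h) ^ 2 := by nlinarith
    have h3 := mul_nonneg h2 (sq_nonneg ‖gradient f p‖)
    linarith
  rw [abs_of_nonneg hh0] at habs hLh
  refine ⟨h, hh0, habs, by rw [← hh]; abel, ?_⟩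
  have hsub : (fun a : ℝ => p + (-a) • gradient f p) '' Icc 0 h ⊆
      connectedComponentIn {z | f q ≤ f z} q := by
    refine (isPreconnected_Icc.image _ (by fun_prop)).subset_connectedComponentIn
      ⟨h, ⟨hh0, le_rfl⟩, hqp.symm⟩ ?_
    rintro _ ⟨a, ⟨ha0, hah⟩, rfl⟩
    change f q ≤ f _
    set g := gradient f p with hg
    set y := p + (-a) • g with hy
    have hqy : q = y + (-(h - a)) • g := by rw [hy, hqp, add_assoc, ← add_smul]; congr 2; ring
    have h1 := (abs_le.mp (abs_sub_sub_inner_gradient_le hd hL0.le hL y ((-(h - a)) • g))).2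
    rw [← hqy, norm_smul, mul_pow, Real.norm_eq_abs, sq_abs, inner_smul_right] at h1
    have h2 : (1 - L * a) * ‖g‖ ^ 2 ≤ ⟪gradient f y, g⟫ := by
      have h3 := hL p y
      have h4 : ‖p - y‖ = a * ‖g‖ := by
        rw [hy, sub_add_cancel_left, neg_smul, neg_neg, norm_smul, Real.norm_of_nonneg ha0]
      have h5 := real_inner_le_norm (gradient f p - gradient f y) g
      rw [inner_sub_left, ← hg, real_inner_self_eq_norm_sq] at h5
      rw [h4, ← hg] at h3
      have h6 := mul_le_mul_of_nonneg_right h3 (norm_nonneg g)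
      nlinarith
    have h3 := mul_le_mul_of_nonneg_left h2 (sub_nonneg.mpr hah)
    have h4 : 0 ≤ (h - a) * (1 - L * h) * ‖g‖ ^ 2 :=
      mul_nonneg (mul_nonneg (sub_nonneg.mpr hah) (by linarith)) (sq_nonneg _)
    nlinarith
  exact hsub ⟨0, ⟨le_rfl, hh0⟩, by simp⟩

lemma ContDiff.gradient_of_two (hf : ContDiff ℝ 2 f) : ContDiff ℝ 1 (gradient f) :=
  (InnerProductSpace.toDual ℝ F).symm.toContinuousLinearEquiv.contDiff.comp
    (hf.fderiv_right (m := 1) (by norm_num))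

lemma norm_gradient_sub_le (hf : ContDiff ℝ 2 f) (hL : ∀ y, ‖fderiv ℝ (gradient f) y‖ ≤ L)
    (y z : F) : ‖gradient f y - gradient f z‖ ≤ L * ‖y - z‖ :=
  convex_univ.norm_image_sub_le_of_norm_fderiv_le (𝕜 := ℝ)
    (fun w _ => (hf.gradient_of_two.differentiable one_ne_zero) w) (fun w _ => hL w)
    (mem_univ z) (mem_univ y)

lemma IsLocalMax.gradient_eq_zero {z : F} (hz : IsLocalMax f z) : gradient f z = 0 := by
  rw [gradient, hz.fderiv_eq_zero, map_zero]

/-- A non-degenerate mode has a neighbourhood which contains the upper level component of each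
of its points, and such that the mode is the only maximizer of `f` over each such component. -/
lemma exists_trapping_nhd [FiniteDimensional ℝ F] (hf : ContDiff ℝ 2 f) (hL0 : 0 < L)
    (hL : ∀ y z, ‖gradient f y - gradient f z‖ ≤ L * ‖y - z‖) {x₀ : F}
    (hmode : IsLocalMax f x₀) (hbij : Function.Bijective (fderiv ℝ (gradient f) x₀)) :
    ∃ W : Set F, IsOpen W ∧ x₀ ∈ W ∧ ∀ y ∈ W,
      connectedComponentIn {z | f y ≤ f z} y ⊆ W ∧
      (∃ r ∈ connectedComponentIn {z | f y ≤ f z} y,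
        ∀ z ∈ connectedComponentIn {z | f y ≤ f z} y, f z ≤ f r) ∧
      ∀ r ∈ connectedComponentIn {z | f y ≤ f z} y,
        (∀ z ∈ connectedComponentIn {z | f y ≤ f z} y, f z ≤ f r) → r = x₀ := by
  have hproper : ProperSpace F := FiniteDimensional.proper ℝ F
  have hcont := hf.continuous
  have hgd := hf.gradient_of_two.differentiable one_ne_zero x₀
  have hisol : ∀ᶠ z in 𝓝 x₀, z ≠ x₀ → gradient f z ≠ 0 := by
    have := hgd.hasFDerivAt.eventually_ne (c := 0)
      (by
        obtain ⟨K, -, hK⟩ := (fderiv ℝ (gradient f) x₀).toLinearMap.exists_antilipschitzWith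
          (LinearMap.ker_eq_bot.mpr hbij.1)
        exact ⟨K, hK⟩)
    exact eventually_nhdsWithin_iff.mp this
  obtain ⟨ε, hε, hball⟩ := Metric.eventually_nhds_iff_ball.mp
    (hisol.and (eventually_eventually_nhds.mpr hmode))
  set ρ := ε / 2 with hρ
  have hρ0 : 0 < ρ := by positivity
  have hcrit : ∀ z ∈ closedBall x₀ ρ, gradient f z = 0 → z = x₀ := fun z hz hg => by
    by_contra hne
    exact (hball z (closedBall_subset_ball (by linarith) hz)).1 hne hg
  have hsphere : ∀ z ∈ sphere x₀ ρ, f z < f x₀ := fun z hz => by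
    have hz' := hball z (closedBall_subset_ball (by linarith) (sphere_subset_closedBall hz))
    refine lt_of_le_of_ne hz'.2.self_of_nhds fun heq => ?_
    have hzmax : IsLocalMax f z := hz'.2.mono fun w hw => hw.trans heq.ge
    have := hcrit z (sphere_subset_closedBall hz) hzmax.gradient_eq_zero
    rw [this, mem_sphere, dist_self] at hz
    exact hρ0.ne hz
  obtain ⟨m, hm, hmle⟩ : ∃ m < f x₀, ∀ z ∈ sphere x₀ ρ, f z ≤ m := by
    rcases (sphere x₀ ρ).eq_empty_or_nonempty with h | h
    · exact ⟨f x₀ - 1, by linarith, by simp [h]⟩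
    · obtain ⟨w, hw, hwmax⟩ := (isCompact_sphere x₀ ρ).exists_isMaxOn h hcont.continuousOn
      exact ⟨f w, hsphere w hw, fun z hz => hwmax hz⟩
  refine ⟨ball x₀ ρ ∩ {z | m < f z}, isOpen_ball.inter (isOpen_lt continuous_const hcont),
    ⟨mem_ball_self hρ0, hm⟩, fun y hy => ?_⟩
  set C := connectedComponentIn {z | f y ≤ f z} y with hC
  have hyC : y ∈ C := mem_connectedComponentIn (le_refl (f y))
  have hCf : ∀ z ∈ C, f y ≤ f z := connectedComponentIn_subset {z | f y ≤ f z} y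
  have hCball : C ⊆ ball x₀ ρ := by
    refine isPreconnected_connectedComponentIn.subset_left_of_subset_union isOpen_ball
      (isClosed_closedBall (x := x₀) (ε := ρ)).isOpen_compl ?_ ?_ ⟨y, hyC, hy.1⟩
    · exact disjoint_compl_right_iff_subset.mpr ball_subset_closedBall
    · intro z hz
      rcases lt_trichotomy (dist z x₀) ρ with h | h | h
      · exact Or.inl h
      · exact absurd (hmle z h) (not_le.mpr (hy.2.trans_le (hCf z hz)))
      · exact Or.inr (by simpa using h)
  have hCclosed : IsClosed C := by
    refine isClosed_of_closure_subset ?_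
    refine isPreconnected_connectedComponentIn.closure.subset_connectedComponentIn
      (subset_closure hyC) ?_
    exact closure_minimal (connectedComponentIn_subset _ _)
      (isClosed_le continuous_const hcont)
  have hCcompact : IsCompact C :=
    Metric.isCompact_of_isClosed_isBounded hCclosed (isBounded_ball.subset hCball)
  refine ⟨fun z hz => ⟨hCball hz, hy.2.trans_le (hCf z hz)⟩, ?_, fun r hr hmax => ?_⟩
  · obtain ⟨r, hr, hmax⟩ := hCcompact.exists_isMaxOn ⟨y, hyC⟩ hcont.continuousOn
    exact ⟨r, hr, fun z hz => hmax hz⟩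
  · exact hcrit r (ball_subset_closedBall (hCball hr))
      (gradient_eq_zero_of_isMax_connectedComponentIn (hf.differentiable two_ne_zero) hL0 hL hr
        hmax)

end GradientEstimates

section GradientFlow

variable {f : EuclideanSpace ℝ (Fin d) → ℝ} {L G : ℝ} {x x₀ : EuclideanSpace ℝ (Fin d)}
  {γ : ℝ → EuclideanSpace ℝ (Fin d)}

/-- A gradient flow line reaching a critical point is constant. -/
lemma IsGradientFlow.eq_of_gradient_eq_zero (hγ : IsGradientFlow f x γ) (hL0 : 0 ≤ L)
    (hL : ∀ y z, ‖gradient f y - gradient f z‖ ≤ L * ‖y - z‖) {s : ℝ} (hs : 0 ≤ s)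
    (hg : gradient f (γ s) = 0) {t : ℝ} (ht : 0 ≤ t) : γ t = x := by
  have hlip : LipschitzOnWith L.toNNReal (gradient f) univ :=
    LipschitzOnWith.of_dist_le_mul fun y _ z _ => by
      simpa [dist_eq_norm, Real.coe_toNNReal _ hL0] using hL y z
  have hc : ∀ a b, 0 ≤ a → ContinuousOn γ (Icc a b) := fun a b ha r hr =>
    (hγ.2 r (ha.trans hr.1)).continuousAt.continuousWithinAt
  have hback : EqOn γ (fun _ => γ s) (Icc 0 s) :=
    ODE_solution_unique_of_mem_Icc_left (v := fun _ => gradient f) (s := fun _ => univ)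
      (fun _ _ => hlip) (hc 0 s le_rfl) (fun r hr => (hγ.2 r hr.1.le).hasDerivWithinAt)
      (fun _ _ => mem_univ _) continuousOn_const
      (fun r _ => by rw [hg]; exact hasDerivWithinAt_const ..) (fun _ _ => mem_univ _) rfl
  have hxs : x = γ s := hγ.1 ▸ hback ⟨le_rfl, hs⟩
  rw [← hxs] at hg
  exact ODE_solution_unique_of_mem_Icc_right (v := fun _ => gradient f) (s := fun _ => univ)
      (g := fun _ => x)
      (fun _ _ => hlip) (hc 0 t le_rfl) (fun r hr => (hγ.2 r hr.1).hasDerivWithinAt)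
      (fun _ _ => mem_univ _) continuousOn_const
      (fun r _ => by rw [hg]; exact hasDerivWithinAt_const ..) (fun _ _ => mem_univ _) hγ.1
      ⟨ht, le_rfl⟩

/-- Local truncation error of the implicit Euler scheme along a gradient flow line. -/
lemma IsGradientFlow.norm_sub_sub_smul_le (hγ : IsGradientFlow f x γ) (hL0 : 0 ≤ L)
    (hL : ∀ y z, ‖gradient f y - gradient f z‖ ≤ L * ‖y - z‖)
    (hG : ∀ y, ‖gradient f y‖ ≤ G) {s h : ℝ} (hs : 0 ≤ s) (hh : 0 ≤ h) :
    ‖γ (s + h) - γ s - h • gradient f (γ (s + h))‖ ≤ L * G * h ^ 2 := by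
  have hG0 : 0 ≤ G := (norm_nonneg _).trans (hG x)
  have hlip : ∀ a ∈ Icc s (s + h), ‖γ a - γ (s + h)‖ ≤ G * h := fun a ha => by
    have := (convex_Icc s (s + h)).norm_image_sub_le_of_norm_hasDerivWithin_le
      (fun r hr => (hγ.2 r (hs.trans hr.1)).hasDerivWithinAt) (fun r _ => hG (γ r))
      (right_mem_Icc.mpr (by linarith)) ha
    refine this.trans ?_
    gcongr
    rw [Real.norm_eq_abs, abs_le]
    constructor <;> linarith [ha.1, ha.2]
  have h1 := (convex_Icc s (s + h)).norm_image_sub_le_of_norm_hasDerivWithin_le (C := L * (G * h))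
    (f := fun a => γ a - a • gradient f (γ (s + h)))
    (f' := fun a => gradient f (γ a) - (1 : ℝ) • gradient f (γ (s + h)))
    (fun r hr => ((hγ.2 r (hs.trans hr.1)).sub
      ((hasDerivAt_id r).smul_const _)).hasDerivWithinAt)
    (fun r hr => by
      rw [one_smul]
      exact (hL _ _).trans (mul_le_mul_of_nonneg_left (hlip r hr) hL0))
    (left_mem_Icc.mpr (by linarith)) (right_mem_Icc.mpr (by linarith))
  have h2 : γ (s + h) - γ s - h • gradient f (γ (s + h)) =
      γ (s + h) - (s + h) • gradient f (γ (s + h)) - (γ s - s • gradient f (γ (s + h))) := by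
    rw [add_smul]; abel
  rw [h2]
  refine h1.trans_eq ?_
  rw [add_sub_cancel_left, Real.norm_of_nonneg hh]
  ring

/-- Error propagation of the implicit Euler scheme for the gradient flow. -/
lemma IsGradientFlow.norm_implicit_euler_sub_le (hγ : IsGradientFlow f x γ) (hL0 : 0 < L)
    (hL : ∀ y z, ‖gradient f y - gradient f z‖ ≤ L * ‖y - z‖)
    (hG : ∀ y, ‖gradient f y‖ ≤ G) {s h B : ℝ} (hs : 0 ≤ s) (hh : 0 ≤ h)
    (hLh : L * h ≤ 1 / 2) (hB : L * G * h ≤ B) {q p : EuclideanSpace ℝ (Fin d)}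
    (hp : p = q + h • gradient f p) (hq : ‖q - γ s‖ ≤ B * s * Real.exp (2 * L * s)) :
    ‖p - γ (s + h)‖ ≤ B * (s + h) * Real.exp (2 * L * (s + h)) := by
  have hG0 : 0 ≤ G := (norm_nonneg _).trans (hG x)
  have hB0 : 0 ≤ B := le_trans (by positivity) hB
  set e := ‖p - γ (s + h)‖ with he
  have h1 : e ≤ ‖q - γ s‖ + h * (L * e) + L * G * h ^ 2 := by
    have hdec : p - γ (s + h) = (q - γ s) + h • (gradient f p - gradient f (γ (s + h))) -
        (γ (s + h) - γ s - h • gradient f (γ (s + h))) := by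
      nth_rewrite 1 [hp]
      rw [smul_sub]; abel
    have h2 : ‖h • (gradient f p - gradient f (γ (s + h)))‖ ≤ h * (L * e) := by
      rw [norm_smul, Real.norm_of_nonneg hh]
      gcongr
      exact hL _ _
    calc e ≤ _ := by rw [he, hdec]; exact norm_sub_le _ _
      _ ≤ _ := add_le_add ((norm_add_le _ _).trans (by gcongr))
        (hγ.norm_sub_sub_smul_le hL0.le hL hG hs hh)
  have h2 : (1 - L * h) * e ≤ B * s * Real.exp (2 * L * s) + B * h := by
    have := mul_le_mul_of_nonneg_right hB hh
    nlinarith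
  have h3 : 1 ≤ Real.exp (2 * L * h) * (1 - L * h) := by
    have h4 := Real.add_one_le_exp (2 * L * h)
    have h5 : 0 ≤ L * h := by positivity
    nlinarith
  have h4 : Real.exp (2 * L * (s + h)) = Real.exp (2 * L * h) * Real.exp (2 * L * s) := by
    rw [← Real.exp_add]; ring_nf
  have h5 : 1 ≤ Real.exp (2 * L * s) := Real.one_le_exp (by positivity)
  calc e = 1 * e := (one_mul e).symm
    _ ≤ Real.exp (2 * L * h) * (1 - L * h) * e := by gcongr
    _ = Real.exp (2 * L * h) * ((1 - L * h) * e) := mul_assoc ..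
    _ ≤ Real.exp (2 * L * h) * (B * s * Real.exp (2 * L * s) + B * h) := by gcongr
    _ ≤ Real.exp (2 * L * h) * (B * s * Real.exp (2 * L * s) + B * h * Real.exp (2 * L * s)) := by
      have h6 : B * h ≤ B * h * Real.exp (2 * L * s) :=
        le_mul_of_one_le_right (by positivity) h5
      exact mul_le_mul_of_nonneg_left (by linarith) (Real.exp_pos _).le
    _ = _ := by rw [h4]; ring

end GradientFlow

section Algorithm

variable {f : EuclideanSpace ℝ (Fin d) → ℝ} {x xstar : EuclideanSpace ℝ (Fin d)} {η : ℝ}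

lemma exists_isProjOn {A : Set (EuclideanSpace ℝ (Fin d))} (hA : IsClosed A) (hne : A.Nonempty)
    (y : EuclideanSpace ℝ (Fin d)) : ∃ p, IsProjOn A y p := by
  obtain ⟨p, hp, h⟩ := hA.exists_infDist_eq_dist hne y
  exact ⟨p, hp, h.symm⟩

/-- If `f` is bounded above, some choice of projections makes the algorithm reach its stopping
rule. -/
lemma exists_run_until_halt (hf : Continuous f) {M : ℝ} (hM : ∀ y, f y ≤ M) (hη : 0 < η) :
    ∃ (q : ℕ → EuclideanSpace ℝ (Fin d)) (K : ℕ), q 0 = x ∧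
      (∀ k < K,
        IsProjOn {y | f y = f x + ((k : ℝ) + 1) * η} (q k) (q (k + 1)) ∧
        q (k + 1) ∈ connectedComponentIn {y | f x + (k : ℝ) * η ≤ f y} (q k)) ∧
      ({y | f y = f x + ((K : ℝ) + 1) * η} = ∅ ∨
        ∃ p, IsProjOn {y | f y = f x + ((K : ℝ) + 1) * η} (q K) p ∧
          p ∉ connectedComponentIn {y | f x + (K : ℝ) * η ≤ f y} (q K)) := by
  classical
  have hstep : ∀ (k : ℕ) (y : EuclideanSpace ℝ (Fin d)), ∃ p,
      {y | f y = f x + ((k : ℝ) + 1) * η}.Nonempty →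
        IsProjOn {y | f y = f x + ((k : ℝ) + 1) * η} y p := fun k y => by
    by_cases h : {y | f y = f x + ((k : ℝ) + 1) * η}.Nonempty
    · obtain ⟨p, hp⟩ := exists_isProjOn (isClosed_eq hf continuous_const) h y
      exact ⟨p, fun _ => hp⟩
    · exact ⟨y, fun h' => absurd h' h⟩
  choose next hnext using hstep
  let q : ℕ → EuclideanSpace ℝ (Fin d) := fun k => Nat.rec x next k
  let halts : ℕ → Prop := fun k => {y | f y = f x + ((k : ℝ) + 1) * η} = ∅ ∨
    ∃ p, IsProjOn {y | f y = f x + ((k : ℝ) + 1) * η} (q k) p ∧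
      p ∉ connectedComponentIn {y | f x + (k : ℝ) * η ≤ f y} (q k)
  have hhalt : ∃ k, halts k := by
    obtain ⟨k, hk⟩ := exists_nat_gt ((M - f x) / η)
    refine ⟨k, Or.inl (eq_empty_of_forall_notMem fun y hy => ?_)⟩
    rw [div_lt_iff₀ hη] at hk
    have h1 : f y = f x + ((k : ℝ) + 1) * η := hy
    have := hM y
    linarith
  refine ⟨q, Nat.find hhalt, rfl, fun k hk => ?_, Nat.find_spec hhalt⟩
  obtain ⟨hne, hcomp⟩ := not_or.mp (Nat.find_min hhalt hk)
  have hproj : IsProjOn {y | f y = f x + ((k : ℝ) + 1) * η} (q k) (q (k + 1)) :=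
    hnext k (q k) (nonempty_iff_ne_empty.mpr hne)
  refine ⟨hproj, ?_⟩
  by_contra hnot
  exact hcomp ⟨_, hproj, hnot⟩

/-- Correctness of the algorithm, given a trapping set `W` of the mode and a set `T` from which
each projection step either stays in `T` or reaches `W`, without triggering the stopping rule. -/
lemma alg1_correct_of_trapping (hf : Continuous f) {M : ℝ} (hM : ∀ y, f y ≤ M) (hη : 0 < η)
    {W T : Set (EuclideanSpace ℝ (Fin d))}
    (hW : ∀ y ∈ W, connectedComponentIn {z | f y ≤ f z} y ⊆ W ∧
      (∃ r ∈ connectedComponentIn {z | f y ≤ f z} y,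
        ∀ z ∈ connectedComponentIn {z | f y ≤ f z} y, f z ≤ f r) ∧
      ∀ r ∈ connectedComponentIn {z | f y ≤ f z} y,
        (∀ z ∈ connectedComponentIn {z | f y ≤ f z} y, f z ≤ f r) → r = xstar)
    (hT : ∀ y ∈ T, y ∉ W → {z | f z = f y + η}.Nonempty ∧
      ∀ p, IsProjOn {z | f z = f y + η} y p →
        p ∈ connectedComponentIn {z | f y ≤ f z} y ∧ p ∈ T)
    (hx : x ∈ W ∪ T) :
    (∃ q K r, Alg1Run f x η q K r) ∧ ∀ q K r, Alg1Run f x η q K r → r = xstar := by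
  have hinv : ∀ (q : ℕ → EuclideanSpace ℝ (Fin d)) (K : ℕ), q 0 = x →
      (∀ k < K,
        IsProjOn {y | f y = f x + ((k : ℝ) + 1) * η} (q k) (q (k + 1)) ∧
        q (k + 1) ∈ connectedComponentIn {y | f x + (k : ℝ) * η ≤ f y} (q k)) →
      ∀ k ≤ K, f x + k * η = f (q k) ∧ q k ∈ W ∪ T := by
    intro q K h0 hrun k
    induction k with
    | zero => exact fun _ => by simpa [h0] using hx
    | succ k ih =>
      intro hk
      obtain ⟨hlev, hmem⟩ := ih (by omega)
      obtain ⟨hproj, hcomp⟩ := hrun k (by omega)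
      have hlev' : f x + ((k : ℝ) + 1) * η = f (q k) + η := by rw [← hlev]; ring
      refine ⟨by push_cast; exact (show f _ = _ from hproj.1).symm, ?_⟩
      rw [hlev] at hcomp
      rw [hlev'] at hproj
      by_cases hqW : q k ∈ W
      · exact Or.inl ((hW _ hqW).1 hcomp)
      · exact Or.inr ((hT _ (hmem.resolve_left hqW) hqW).2 _ hproj).2
  have hfinal : ∀ (q : ℕ → EuclideanSpace ℝ (Fin d)) (K : ℕ), q 0 = x →
      (∀ k < K,
        IsProjOn {y | f y = f x + ((k : ℝ) + 1) * η} (q k) (q (k + 1)) ∧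
        q (k + 1) ∈ connectedComponentIn {y | f x + (k : ℝ) * η ≤ f y} (q k)) →
      ({y | f y = f x + ((K : ℝ) + 1) * η} = ∅ ∨
        ∃ p, IsProjOn {y | f y = f x + ((K : ℝ) + 1) * η} (q K) p ∧
          p ∉ connectedComponentIn {y | f x + (K : ℝ) * η ≤ f y} (q K)) →
      f x + K * η = f (q K) ∧ q K ∈ W := by
    intro q K h0 hrun hhalt
    obtain ⟨hlev, hmem⟩ := hinv q K h0 hrun K le_rfl
    refine ⟨hlev, ?_⟩
    by_contra hqW
    have hlev' : f x + ((K : ℝ) + 1) * η = f (q K) + η := by rw [← hlev]; ring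
    rw [hlev', hlev] at hhalt
    obtain ⟨hne, hproj⟩ := hT _ (hmem.resolve_left hqW) hqW
    rcases hhalt with hempty | ⟨p, hp, hnot⟩
    · exact hne.ne_empty hempty
    · exact hnot (hproj p hp).1
  refine ⟨?_, ?_⟩
  · obtain ⟨q, K, h0, hrun, hhalt⟩ := exists_run_until_halt (x := x) hf hM hη
    obtain ⟨hlev, hqW⟩ := hfinal q K h0 hrun hhalt
    obtain ⟨r, hr, hmax⟩ := (hW _ hqW).2.1
    refine ⟨q, K, r, h0, hrun, hhalt, ?_⟩
    rw [hlev]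
    exact ⟨hr, hmax⟩
  · rintro q K r ⟨h0, hrun, hhalt, hr, hmax⟩
    obtain ⟨hlev, hqW⟩ := hfinal q K h0 hrun hhalt
    rw [hlev] at hr hmax
    exact (hW _ hqW).2.2 r hr hmax

end Algorithm

/-- For all sufficiently small `η > 0`, Algorithm 1 started at a point `x` in the
basin of attraction of a mode `x_*` terminates and returns `x_*`. -/
theorem alg1_returns_mode (f : EuclideanSpace ℝ (Fin d) → ℝ) (hf : StandingAssumptions f)
    (x xstar : EuclideanSpace ℝ (Fin d)) (hmode : IsLocalMax f xstar)
    (hbasin : InBasin f xstar x) :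
    ∃ η₀ > 0, ∀ η : ℝ, 0 < η → η ≤ η₀ →
      (∃ q K r, Alg1Run f x η q K r) ∧
      (∀ q K r, Alg1Run f x η q K r → r = xstar) := by
  obtain ⟨hf2, ⟨M, hM⟩, ⟨G', hG'⟩, ⟨L', hL'⟩, -, hmorse⟩ := hf
  obtain ⟨γ, hγ, hlim⟩ := hbasin
  obtain ⟨G, hG0, hG⟩ : ∃ G > 0, ∀ y, ‖gradient f y‖ ≤ G :=
    ⟨max G' 1, by positivity, fun y => (hG' y).trans (le_max_left _ _)⟩
  obtain ⟨L, hL0, hL⟩ : ∃ L > 0, ∀ y z, ‖gradient f y - gradient f z‖ ≤ L * ‖y - z‖ :=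
    ⟨max L' 1, by positivity, norm_gradient_sub_le hf2 fun y => (hL' y).trans (le_max_left _ _)⟩
  obtain ⟨W, hWo, hxW, hW⟩ :=
    exists_trapping_nhd hf2 hL0 hL hmode (hmorse _ hmode.gradient_eq_zero)
  have hM' : ∀ y, f y ≤ M := fun y => (abs_le.mp (hM y)).2
  by_cases hcrit : ∃ s, 0 ≤ s ∧ gradient f (γ s) = 0
  · obtain ⟨s, hs, hgs⟩ := hcrit
    have hx : xstar = x := by
      refine tendsto_nhds_unique hlim (tendsto_const_nhds.congr' ?_)
      filter_upwards [eventually_ge_atTop 0] with t ht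
      exact (hγ.eq_of_gradient_eq_zero hL0.le hL hs hgs ht).symm
    exact ⟨1, one_pos, fun η hη _ =>
      alg1_correct_of_trapping (T := ∅) hf2.continuous hM' hη hW (by simp) (Or.inl (hx ▸ hxW))⟩
  push Not at hcrit
  obtain ⟨ρ, hρ, hρW⟩ := Metric.isOpen_iff.mp hWo xstar hxW
  obtain ⟨T, hT0, hT⟩ : ∃ T ≥ 0, ∀ s ≥ T, dist (γ s) xstar < ρ / 2 := by
    obtain ⟨T, hT⟩ := Filter.eventually_atTop.mp
      (hlim.eventually (ball_mem_nhds xstar (half_pos hρ)))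
    exact ⟨max T 0, le_max_right _ _, fun s hs => hT s ((le_max_left _ _).trans hs)⟩
  obtain ⟨c, hc, hcle⟩ : ∃ c > 0, ∀ s ∈ Icc 0 T, 2 * c ≤ ‖gradient f (γ s)‖ := by
    have hcont : ContinuousOn (fun s => ‖gradient f (γ s)‖) (Icc 0 T) := fun s hs =>
      (hf2.gradient_of_two.continuous.continuousAt.comp
        (hγ.2 s hs.1).continuousAt).norm.continuousWithinAt
    obtain ⟨s, hs, hmin⟩ := isCompact_Icc.exists_isMinOn (nonempty_Icc.mpr hT0) hcont
    have hpos : 0 < ‖gradient f (γ s)‖ := norm_pos_iff.mpr (hcrit s hs.1)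
    exact ⟨‖gradient f (γ s)‖ / 2, by positivity, fun t ht => by
      have : ‖gradient f (γ s)‖ ≤ ‖gradient f (γ t)‖ := hmin ht
      linarith⟩
  set H := 4 * G / c ^ 3 with hH
  set A := L * G * H with hA
  set N := A * (T + 1) * Real.exp (2 * L * (T + 1)) with hN
  have hH0 : 0 < H := by positivity
  have hA0 : 0 < A := by positivity
  have hN0 : 0 < N := by positivity
  obtain ⟨η₀, hη₀, hsmall⟩ : ∃ η₀ > 0, ∀ η, 0 < η → η ≤ η₀ →
      N * η ≤ c / L ∧ N * η ≤ ρ / 2 ∧ 8 * G * L * η ≤ c ^ 3 ∧ H * η ≤ 1 := by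
    refine ⟨min (min (c / L / N) (ρ / 2 / N)) (min (c ^ 3 / (8 * G * L)) (1 / H)),
      by positivity, fun η _ hle => ?_⟩
    simp only [le_min_iff] at hle
    obtain ⟨⟨h1, h2⟩, h3, h4⟩ := hle
    exact ⟨(le_div_iff₀' hN0).mp h1, (le_div_iff₀' hN0).mp h2,
      (le_div_iff₀' (by positivity)).mp h3, (le_div_iff₀' hH0).mp h4⟩
  refine ⟨η₀, hη₀, fun η hη hle => ?_⟩
  obtain ⟨hN1, hN2, hGL, hH1⟩ := hsmall η hη hle
  have herr : ∀ s, 0 ≤ s → s ≤ T + 1 → A * η * s * Real.exp (2 * L * s) ≤ N * η :=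
    fun s hs0 hs => by
      calc A * η * s * Real.exp (2 * L * s)
          ≤ A * η * (T + 1) * Real.exp (2 * L * (T + 1)) := by gcongr
        _ = N * η := by rw [hN]; ring
  refine alg1_correct_of_trapping hf2.continuous hM' hη hW
    (T := {y | ∃ s, 0 ≤ s ∧ s ≤ T + 1 ∧ ‖y - γ s‖ ≤ A * η * s * Real.exp (2 * L * s)})
    ?_ (Or.inr ⟨0, le_rfl, by linarith, by simp [hγ.1]⟩)
  rintro y ⟨s, hs0, hs1, hy⟩ hyW
  have hyN := hy.trans (herr s hs0 hs1)
  have hsT : s ≤ T := by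
    by_contra! hlt
    refine hyW (hρW ?_)
    have h1 := dist_triangle y (γ s) xstar
    rw [dist_eq_norm y (γ s)] at h1
    have h2 := hT s hlt.le
    rw [mem_ball]
    linarith
  have hgy : c ≤ ‖gradient f y‖ := by
    have h1 := hcle s ⟨hs0, hsT⟩
    have h2 := hL (γ s) y
    have h3 := norm_sub_norm_le (gradient f (γ s)) (gradient f y)
    have h4 : L * ‖γ s - y‖ ≤ c := by
      rw [norm_sub_rev, ← le_div_iff₀' hL0]
      exact hyN.trans hN1
    linarith
  refine ⟨?_, fun p hp => ?_⟩
  · obtain ⟨z, hz, -⟩ := exists_level_dist_le (hf2.differentiable two_ne_zero) hL0 hL hG hc hη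
      hGL hgy
    exact ⟨z, hz⟩
  · obtain ⟨h, hh0, hhH, hph, hcomp⟩ := exists_implicit_euler_step (hf2.of_le one_le_two) hL0 hL
      hG hc hη hGL hgy hp.1 fun z hz => hp.2.trans_le (infDist_le_dist_of_mem hz)
    refine ⟨hcomp, s + h, by positivity, by linarith, ?_⟩
    refine hγ.norm_implicit_euler_sub_le hL0 hL hG hs0 hh0 ?_ ?_ hph hy
    · calc L * h ≤ L * (H * η) := by gcongr
        _ = 8 * G * L * η / c ^ 3 / 2 := by rw [hH]; ring
        _ ≤ 1 / 2 := by
          gcongr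
          rw [div_le_one (by positivity)]; exact hGL
    · calc L * G * h ≤ L * G * (H * η) := by gcongr
        _ = A * η := by rw [hA]; ring
end
end

section
/- Let f : ℝ^d → ℝ satisfy the standing assumptions, and let x lie in the basin of attraction of a mode x_* of f. For η > 0 let (q_k) be the sequence produced by Algorithm 1 started at x with level step η (q_0 = x and q_k a metric projection of q_{k−1} onto L_{f(x)+kη}, with the stopping rule of Algorithm 1). Then, as η → 0, the polygonal line obtained by connecting consecutive points of the sequence (q_k) converges, in Hausdorff distance, to the gradient ascent line {γ_x(t) : t ≥ 0} ∪ {x_*} originating at x. -/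
open Metric Set Filter Topology MeasureTheory

noncomputable section

variable {d : ℕ}

/-- The polygonal line connecting the consecutive points `q 0, q 1, …, q K`. -/
def Polyline (q : ℕ → EuclideanSpace ℝ (Fin d)) (K : ℕ) : Set (EuclideanSpace ℝ (Fin d)) :=
  {q 0} ∪ ⋃ k ∈ Finset.range K, segment ℝ (q k) (q (k + 1))

section Flow

variable {E : Type*} [NormedAddCommGroup E] [NormedSpace ℝ E] {g : E → E} {M G : ℝ}

/-- The consistency estimate for one step of the explicit Euler scheme along a trajectory of a
bounded Lipschitz vector field. -/
lemma norm_sub_sub_smul_le {γ : ℝ → E} (hγ : ∀ t, 0 ≤ t → HasDerivAt γ (g (γ t)) t)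
    (hM : ∀ a b, ‖g a - g b‖ ≤ M * ‖a - b‖) (hM0 : 0 ≤ M) (hG : ∀ y, ‖g y‖ ≤ G)
    {s t : ℝ} (hs : 0 ≤ s) (hst : s ≤ t) :
    ‖γ t - γ s‖ ≤ G * (t - s) ∧
    ‖γ t - γ s - (t - s) • g (γ s)‖ ≤ M * G * (t - s) ^ 2 := by
  have hlip : ∀ u, s ≤ u → ‖γ u - γ s‖ ≤ G * (u - s) := fun u hu => by
    have := (convex_Ici (0 : ℝ)).norm_image_sub_le_of_norm_hasDerivWithin_le (f := γ) (C := G)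
      (fun v hv => (hγ v hv).hasDerivWithinAt) (fun v _ => hG _) hs (hs.trans hu)
    rwa [Real.norm_of_nonneg (sub_nonneg.2 hu)] at this
  refine ⟨hlip t hst, ?_⟩
  have hG0 : 0 ≤ G := (norm_nonneg _).trans (hG (γ s))
  have := (convex_Icc s t).norm_image_sub_le_of_norm_hasDerivWithin_le
    (f := fun u => γ u - (u - s) • g (γ s)) (f' := fun u => g (γ u) - g (γ s))
    (C := M * (G * (t - s)))
    (fun v hv => ?_) (fun v hv => ?_) (left_mem_Icc.2 hst) (right_mem_Icc.2 hst)
  · rw [Real.norm_of_nonneg (sub_nonneg.2 hst)] at this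
    simp only [sub_self, zero_smul, sub_zero] at this
    calc _ = ‖γ t - (t - s) • g (γ s) - γ s‖ := by congr 1; abel
      _ ≤ _ := this.trans_eq (by ring)
  · have h1 := (hγ v (hs.trans hv.1)).sub
      (((hasDerivAt_id v).sub_const s).smul_const (g (γ s)))
    simp only [one_smul] at h1
    exact h1.hasDerivWithinAt
  · refine (hM _ _).trans (mul_le_mul_of_nonneg_left ((hlip v hv.1).trans ?_) hM0)
    exact mul_le_mul_of_nonneg_left (by linarith [hv.2]) hG0

/-- A trajectory of a Lipschitz vector field that meets a zero of the field is constant. -/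
lemma eq_of_flow_meets_zero {γ : ℝ → E} (hγ : ∀ t, 0 ≤ t → HasDerivAt γ (g (γ t)) t)
    (hM : ∀ a b, ‖g a - g b‖ ≤ M * ‖a - b‖) {t₀ : ℝ} (ht₀ : 0 ≤ t₀)
    (h0 : g (γ t₀) = 0) {t : ℝ} (ht : 0 ≤ t) : γ t = γ t₀ := by
  have hL : LipschitzWith M.toNNReal g := LipschitzWith.of_dist_le_mul fun a b => by
    rw [dist_eq_norm, dist_eq_norm]
    exact (hM a b).trans (mul_le_mul_of_nonneg_right (Real.le_coe_toNNReal M) (norm_nonneg _))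
  have hc : ContinuousOn γ (Ici 0) := fun u hu => (hγ u hu).continuousAt.continuousWithinAt
  rcases le_total t t₀ with h | h
  · exact ODE_solution_unique_of_mem_Icc_left (v := fun _ => g) (s := fun _ => univ)
      (f := γ) (g := fun _ => γ t₀) (a := 0) (b := t₀) (fun _ _ => hL.lipschitzOnWith)
      (hc.mono Icc_subset_Ici_self) (fun u hu => (hγ u hu.1.le).hasDerivWithinAt)
      (fun _ _ => trivial) continuousOn_const
      (fun u _ => by rw [h0]; exact hasDerivWithinAt_const _ _ _)
      (fun _ _ => trivial) rfl ⟨ht, h⟩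
  · exact ODE_solution_unique_of_mem_Icc_right (v := fun _ => g) (s := fun _ => univ)
      (f := γ) (g := fun _ => γ t₀) (a := t₀) (b := t) (fun _ _ => hL.lipschitzOnWith)
      (hc.mono fun u hu => ht₀.trans hu.1)
      (fun u hu => (hγ u (ht₀.trans hu.1)).hasDerivWithinAt)
      (fun _ _ => trivial) continuousOn_const
      (fun u _ => by rw [h0]; exact hasDerivWithinAt_const _ _ _)
      (fun _ _ => trivial) rfl ⟨h, le_rfl⟩

end Flow

section Gradient

variable {E : Type*} [NormedAddCommGroup E] [InnerProductSpace ℝ E] [CompleteSpace E]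
  {f : E → ℝ} {g : E → E} {M : ℝ}

/-- First-order Taylor expansion of a function with Lipschitz gradient. -/
lemma abs_sub_sub_inner_le (hg : ∀ y, HasGradientAt f (g y) y)
    (hM : ∀ a b, ‖g a - g b‖ ≤ M * ‖a - b‖) (hM0 : 0 ≤ M) (y z : E) :
    |f z - f y - inner ℝ (g y) (z - y)| ≤ M * ‖z - y‖ ^ 2 := by
  have key := (convex_segment (𝕜 := ℝ) y z).norm_image_sub_le_of_norm_hasFDerivWithin_le'
    (f := f) (f' := fun w => InnerProductSpace.toDual ℝ E (g w))
    (φ := InnerProductSpace.toDual ℝ E (g y)) (C := M * ‖z - y‖)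
    (fun w _ => (hg w).hasFDerivAt.hasFDerivWithinAt) ?_
    (left_mem_segment ℝ y z) (right_mem_segment ℝ y z)
  · simpa [pow_two, mul_assoc] using key
  · intro w hw
    rw [← map_sub, LinearIsometryEquiv.norm_map]
    refine (hM w y).trans (mul_le_mul_of_nonneg_left ?_ hM0)
    simpa only [norm_sub_rev] using norm_sub_le_of_mem_segment hw

/-- Near a regular point, the next level is attained close to the point. -/
lemma exists_level_dist_le_s1 (hg : ∀ y, HasGradientAt f (g y) y)
    (hM : ∀ a b, ‖g a - g b‖ ≤ M * ‖a - b‖) (hM0 : 0 ≤ M) {q : E} (hq : g q ≠ 0)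
    {η a : ℝ} (hη : 0 < η) (ha : 4 * M * η ≤ a * ‖g q‖ ^ 2) (ha0 : 0 ≤ a) (ha1 : a ≤ 1) :
    ∃ y, f y = f q + η ∧ dist q y ≤ (1 + a) * (η / ‖g q‖) := by
  have hn : 0 < ‖g q‖ := norm_pos_iff.2 hq
  set n := ‖g q‖ with hn_def
  set s := (1 + a) * (η / n ^ 2) with hs
  have hs0 : 0 ≤ s := by positivity
  have htop : f q + η ≤ f (q + s • g q) := by
    have h := (abs_le.1 (abs_sub_sub_inner_le hg hM hM0 q (q + s • g q))).1
    rw [add_sub_cancel_left, inner_smul_right, real_inner_self_eq_norm_sq, norm_smul,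
      Real.norm_of_nonneg hs0, ← hn_def] at h
    have e1 : s * n ^ 2 = (1 + a) * η := by rw [hs]; field_simp
    have e2 : M * (s * n) ^ 2 ≤ a * η := by
      have : M * (s * n) ^ 2 = M * η * (1 + a) ^ 2 * (η / n ^ 2) := by
        rw [hs]; field_simp
      rw [this, mul_div_assoc', div_le_iff₀ (by positivity)]
      have h4 : (1 + a) ^ 2 ≤ 4 := by nlinarith
      have : M * η * (1 + a) ^ 2 ≤ a * n ^ 2 := by
        nlinarith [mul_le_mul_of_nonneg_left h4 (mul_nonneg hM0 hη.le)]
      nlinarith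
    linarith
  have hcont : Continuous fun u : ℝ => f (q + u • g q) := by
    have : Continuous f := continuous_iff_continuousAt.2 fun y => (hg y).continuousAt
    fun_prop
  obtain ⟨u, hu, hfu⟩ := intermediate_value_Icc hs0 hcont.continuousOn
    (show f q + η ∈ Icc _ _ from ⟨by simp [hη.le], htop⟩)
  refine ⟨_, hfu, ?_⟩
  rw [dist_eq_norm, sub_add_cancel_left, norm_neg, norm_smul, Real.norm_of_nonneg hu.1, ← hn_def]
  calc u * n ≤ s * n := by gcongr; exact hu.2
    _ = _ := by rw [hs]; field_simp

/-- A point on the next level that is about as close as possible to `q` is approximately the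
Euler step of the gradient flow from `q`, and `f` exceeds `f q` on the segment towards it. -/
lemma level_step_estimates (hg : ∀ y, HasGradientAt f (g y) y)
    (hM : ∀ a b, ‖g a - g b‖ ≤ M * ‖a - b‖) (hM0 : 0 ≤ M) {q p : E} (hq : g q ≠ 0)
    {η a : ℝ} (hη : 0 < η) (ha : 4 * M * η ≤ a * ‖g q‖ ^ 2) (ha0 : 0 ≤ a) (ha1 : a ≤ 1 / 2)
    (hp : f p = f q + η) (hd : dist q p ≤ (1 + a) * (η / ‖g q‖)) :
    ‖p - q - (η / ‖g q‖ ^ 2) • g q‖ ^ 2 ≤ 5 * a * (η / ‖g q‖) ^ 2 ∧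
    ∀ y ∈ segment ℝ q p, f q ≤ f y := by
  have hn : 0 < ‖g q‖ := norm_pos_iff.2 hq
  set n := ‖g q‖ with hn_def
  rw [dist_comm, dist_eq_norm] at hd
  have hr : M * ‖p - q‖ ^ 2 ≤ a * η := by
    calc M * ‖p - q‖ ^ 2 ≤ M * ((1 + a) * (η / n)) ^ 2 := by gcongr
      _ = M * η * (1 + a) ^ 2 * (η / n ^ 2) := by field_simp
      _ ≤ a * η := by
        rw [mul_div_assoc', div_le_iff₀ (by positivity)]
        have h4 : (1 + a) ^ 2 ≤ 4 := by nlinarith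
        have : M * η * (1 + a) ^ 2 ≤ a * n ^ 2 := by
          nlinarith [mul_le_mul_of_nonneg_left h4 (mul_nonneg hM0 hη.le)]
        nlinarith
  have hin : (1 - a) * η ≤ inner ℝ (g q) (p - q) := by
    have h := (abs_le.1 (abs_sub_sub_inner_le hg hM hM0 q p)).2
    linarith
  constructor
  · have e : ‖p - q - (η / n ^ 2) • g q‖ ^ 2
        = ‖p - q‖ ^ 2 - 2 * (η / n ^ 2) * inner ℝ (g q) (p - q) + (η / n) ^ 2 := by
      rw [norm_sub_sq_real, inner_smul_right, norm_smul, Real.norm_of_nonneg (by positivity),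
        real_inner_comm, ← hn_def]
      field_simp
    have h1 : ‖p - q‖ ^ 2 ≤ ((1 + a) * (η / n)) ^ 2 := by gcongr
    have h2 : 2 * (η / n ^ 2) * ((1 - a) * η) ≤ 2 * (η / n ^ 2) * inner ℝ (g q) (p - q) := by
      gcongr
    have h3 : 2 * (η / n ^ 2) * ((1 - a) * η) = 2 * (1 - a) * (η / n) ^ 2 := by field_simp
    rw [e]
    nlinarith [mul_nonneg (mul_nonneg ha0 (by linarith : (0 : ℝ) ≤ 1 - a)) (sq_nonneg (η / n))]
  · intro y hy
    rw [segment_eq_image'] at hy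
    obtain ⟨u, hu, rfl⟩ := hy
    have h := (abs_le.1 (abs_sub_sub_inner_le hg hM hM0 q (q + u • (p - q)))).1
    rw [add_sub_cancel_left, inner_smul_right, norm_smul, Real.norm_of_nonneg hu.1] at h
    have h1 : M * (u * ‖p - q‖) ^ 2 ≤ u * (a * η) := by
      calc M * (u * ‖p - q‖) ^ 2 = u * u * (M * ‖p - q‖ ^ 2) := by ring
        _ ≤ u * (a * η) :=
          mul_le_mul (mul_le_of_le_one_right hu.1 hu.2) hr (by positivity) hu.1
    have h2 := mul_le_mul_of_nonneg_left hin hu.1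
    have h3 : 0 ≤ u * (η * (1 - 2 * a)) := mul_nonneg hu.1 (mul_nonneg hη.le (by linarith))
    simp only
    linarith

end Gradient

/-- A preconnected set that avoids a sphere and meets the ball lies in the ball. -/
lemma IsPreconnected.subset_ball_of_disjoint_sphere {X : Type*} [PseudoMetricSpace X] {s : Set X}
    (hs : IsPreconnected s) {c q : X} {ρ : ℝ} (hd : ∀ y ∈ s, dist y c ≠ ρ) (hqs : q ∈ s)
    (hq : q ∈ ball c ρ) : s ⊆ ball c ρ := by
  refine hs.subset_left_of_subset_union isOpen_ball
    (isClosed_closedBall (x := c) (ε := ρ)).isOpen_compl ?_ ?_ ⟨q, hqs, hq⟩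
  · exact disjoint_compl_right_iff_subset.2 ball_subset_closedBall
  · intro y hy
    rcases lt_or_gt_of_ne (hd y hy) with h | h
    · exact Or.inl h
    · exact Or.inr (by simpa using h)

/-- Near a non-degenerate local maximum there are arbitrarily small spheres on which the function
stays below the maximal value. -/
lemma exists_sphere_le_of_isLocalMax {f : EuclideanSpace ℝ (Fin d) → ℝ}
    {c : EuclideanSpace ℝ (Fin d)}
    (hf : Continuous f) (hmax : IsLocalMax f c)
    (hdiff : DifferentiableAt ℝ (gradient f) c)
    (hbij : Function.Injective (fderiv ℝ (gradient f) c)) {δ : ℝ} (hδ : 0 < δ) :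
    ∃ ρ, 0 < ρ ∧ ρ ≤ δ ∧ ∃ m < f c, ∀ y, dist y c = ρ → f y ≤ m := by
  have hne : ∀ᶠ y in 𝓝 c, y ≠ c → gradient f y ≠ 0 := by
    refine eventually_nhdsWithin_iff.1 (hdiff.hasFDerivAt.eventually_ne ?_)
    obtain ⟨C, -, hC⟩ := LinearMap.exists_antilipschitzWith
      (fderiv ℝ (gradient f) c : EuclideanSpace ℝ (Fin d) →ₗ[ℝ] EuclideanSpace ℝ (Fin d))
      (LinearMap.ker_eq_bot.2 hbij)
    exact ⟨C, hC⟩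
  obtain ⟨r, hr, hball⟩ := Metric.eventually_nhds_iff.1
    (hne.and (Filter.Eventually.and hmax (eventually_eventually_nhds.2 hmax)))
  have hlt : ∀ y, dist y c < r → y ≠ c → f y < f c := by
    intro y hy hyc
    obtain ⟨h1, h2, h3⟩ := hball hy
    refine lt_of_le_of_ne h2 fun heq => h1 hyc ?_
    have hy' : IsLocalMax f y := by
      filter_upwards [h3] with z hz
      exact hz.trans heq.ge
    rw [gradient, hy'.fderiv_eq_zero, map_zero]
  refine ⟨min δ (r / 2), by positivity, min_le_left _ _, ?_⟩
  set ρ := min δ (r / 2) with hρ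
  have hρ0 : 0 < ρ := by positivity
  have hρr : ρ < r := (min_le_right _ _).trans_lt (by linarith)
  rcases (sphere c ρ).eq_empty_or_nonempty with h | h
  · exact ⟨f c - 1, by linarith, fun y hy => absurd (show y ∈ sphere c ρ from hy) (by simp [h])⟩
  · obtain ⟨z, hz, hzmax⟩ := (isCompact_sphere c ρ).exists_isMaxOn h hf.continuousOn
    have hz' : dist z c = ρ := hz
    refine ⟨f z, hlt z (hz'.trans_lt hρr) ?_, fun y hy => hzmax hy⟩
    rintro rfl
    simp at hz'
    exact hρ0.ne hz'

section Run

variable {f : EuclideanSpace ℝ (Fin d) → ℝ} {x r : EuclideanSpace ℝ (Fin d)} {η : ℝ}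
  {q : ℕ → EuclideanSpace ℝ (Fin d)} {K : ℕ}

lemma Alg1Run.apply_eq (h : Alg1Run f x η q K r) {k : ℕ} (hk : k ≤ K) :
    f (q k) = f x + k * η := by
  cases k with
  | zero => simp [h.1]
  | succ k =>
    have : f (q (k + 1)) = f x + ((k : ℝ) + 1) * η := (h.2.1 k hk).1.1
    rw [this]
    push_cast
    rfl

/-- Once a run of Algorithm 1 is inside a ball whose bounding sphere lies below the current level,
it stays in that ball. -/
lemma Alg1Run.mem_ball (h : Alg1Run f x η q K r) (hη : 0 ≤ η) {c : EuclideanSpace ℝ (Fin d)}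
    {ρ : ℝ} {N : ℕ} (hs : ∀ y, dist y c = ρ → f y < f x + N * η) (hN : q N ∈ ball c ρ)
    {k : ℕ} (hNk : N ≤ k) (hk : k ≤ K) : q k ∈ ball c ρ := by
  induction k, hNk using Nat.le_induction with
  | base => exact hN
  | succ k hNk ih =>
    have hqk := ih (by omega)
    refine isPreconnected_connectedComponentIn.subset_ball_of_disjoint_sphere (fun y hy hyc => ?_)
      (mem_connectedComponentIn (F := {y | f x + k * η ≤ f y})
        (h.apply_eq (by omega : k ≤ K)).ge) hqk (h.2.1 k hk).2
    have h1 : f x + k * η ≤ f y :=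
      connectedComponentIn_subset {y | f x + k * η ≤ f y} (q k) hy
    have h2 := hs y hyc
    have h3 : (N : ℝ) * η ≤ k * η := by gcongr
    linarith

/-- At a point where the gradient is large compared with the level step, Algorithm 1 does not stop,
and its next step is close to the Euler step of the gradient flow. -/
lemma Alg1Run.step {g : EuclideanSpace ℝ (Fin d) → EuclideanSpace ℝ (Fin d)} {M a : ℝ}
    (h : Alg1Run f x η q K r) (hg : ∀ y, HasGradientAt f (g y) y)
    (hM : ∀ a b, ‖g a - g b‖ ≤ M * ‖a - b‖) (hM0 : 0 ≤ M) (hη : 0 < η) {k : ℕ} (hk : k ≤ K)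
    (hq : g (q k) ≠ 0) (ha : 4 * M * η ≤ a * ‖g (q k)‖ ^ 2) (ha0 : 0 ≤ a) (ha1 : a ≤ 1 / 2) :
    k < K ∧ ‖q (k + 1) - q k‖ ≤ 2 * (η / ‖g (q k)‖) ∧
      ‖q (k + 1) - q k - (η / ‖g (q k)‖ ^ 2) • g (q k)‖ ^ 2 ≤ 5 * a * (η / ‖g (q k)‖) ^ 2 := by
  obtain ⟨y, hy, hyd⟩ := exists_level_dist_le_s1 hg hM hM0 hq hη ha ha0 (by linarith)
  have hlev : f (q k) + η = f x + ((k : ℝ) + 1) * η := by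
    rw [h.apply_eq hk]; ring
  have hdist : ∀ p, IsProjOn {y | f y = f x + ((k : ℝ) + 1) * η} (q k) p →
      f p = f (q k) + η ∧ dist (q k) p ≤ (1 + a) * (η / ‖g (q k)‖) := fun p hp =>
    ⟨Eq.trans hp.1 hlev.symm, hp.2.le.trans ((infDist_le_dist_of_mem
      (s := {y | f y = f x + ((k : ℝ) + 1) * η}) (hy.trans hlev)).trans hyd)⟩
  have hkK : k < K := by
    refine lt_of_le_of_ne hk fun hkK => ?_
    subst hkK
    rcases h.2.2.1 with hempty | ⟨p, hp, hpc⟩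
    · have : y ∈ {y | f y = f x + ((k : ℝ) + 1) * η} := hy.trans hlev
      rw [hempty] at this
      exact this
    · obtain ⟨h1, h2⟩ := hdist p hp
      have h3 := (level_step_estimates hg hM hM0 hq hη ha ha0 ha1 h1 h2).2
      rw [h.apply_eq le_rfl] at h3
      exact hpc ((convex_segment (q k) p).isPreconnected.subset_connectedComponentIn
        (left_mem_segment ℝ _ _) h3 (right_mem_segment ℝ _ _))
  obtain ⟨h1, h2⟩ := hdist _ (h.2.1 k hkK).1
  refine ⟨hkK, ?_, (level_step_estimates hg hM hM0 hq hη ha ha0 ha1 h1 h2).1⟩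
  rw [← dist_eq_norm, dist_comm]
  refine h2.trans ?_
  gcongr
  linarith

/-- A run of Algorithm 1 shadows the gradient flow line up to time `T`, as long as the gradient does
not vanish along the flow line before time `T`. -/
lemma Alg1Run.exists_shadowing {g : EuclideanSpace ℝ (Fin d) → EuclideanSpace ℝ (Fin d)}
    {M G c T ε : ℝ} {γ : ℝ → EuclideanSpace ℝ (Fin d)}
    (h : Alg1Run f x η q K r) (hg : ∀ y, HasGradientAt f (g y) y)
    (hM : ∀ a b, ‖g a - g b‖ ≤ M * ‖a - b‖) (hM0 : 0 ≤ M) (hG : ∀ y, ‖g y‖ ≤ G) (hη : 0 < η)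
    (hγ0 : γ 0 = x) (hγ : ∀ t, 0 ≤ t → HasDerivAt γ (g (γ t)) t) (hc : 0 < c)
    (hT : 0 ≤ T) (hcT : ∀ t, 0 ≤ t → t < T → 2 * c ≤ ‖g (γ t)‖) (hε : 0 ≤ ε)
    (hεc : M * (ε * ((T + 1) * Real.exp (M * (T + 1)))) ≤ c)
    (h1 : η / c ^ 2 ≤ 1) (h2 : 4 * M * (η / c ^ 2) ≤ 1 / 2)
    (h3 : 5 * (4 * M * (η / c ^ 2)) * G ^ 2 ≤ (ε / 2) ^ 2) (h4 : M * G * (η / c ^ 2) ≤ ε / 2) :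
    ∃ N ≤ K, ∃ τ : ℕ → ℝ, τ 0 = 0 ∧ T ≤ τ N ∧
      (∀ k < N, τ k < T ∧ τ (k + 1) ≤ τ k + η / c ^ 2 ∧ ‖q (k + 1) - q k‖ ≤ 2 * (η / c)) ∧
      ∀ k ≤ N, 0 ≤ τ k ∧ ‖q k - γ (τ k)‖ ≤ ε * ((T + 1) * Real.exp (M * (T + 1))) := by
  set τ : ℕ → ℝ := fun k => ∑ j ∈ Finset.range k, η / ‖g (q j)‖ ^ 2 with hτ
  have hτs : ∀ k, τ (k + 1) = τ k + η / ‖g (q k)‖ ^ 2 := fun k => Finset.sum_range_succ _ _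
  have hτ0 : ∀ k, 0 ≤ τ k := fun k => Finset.sum_nonneg fun j _ => by positivity
  have hbound : ∀ t, 0 ≤ t → t ≤ T + 1 →
      ε * (t * Real.exp (M * t)) ≤ ε * ((T + 1) * Real.exp (M * (T + 1))) := by
    intro t ht htT
    gcongr
  have hstep : ∀ k ≤ K, τ k < T → ‖q k - γ (τ k)‖ ≤ ε * (τ k * Real.exp (M * τ k)) →
      k < K ∧ τ (k + 1) ≤ τ k + η / c ^ 2 ∧ ‖q (k + 1) - q k‖ ≤ 2 * (η / c) ∧
      ‖q (k + 1) - γ (τ (k + 1))‖ ≤ ε * (τ (k + 1) * Real.exp (M * τ (k + 1))) := by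
    intro k hk hkT he
    have hgc : c ≤ ‖g (q k)‖ := by
      have e1 := hcT _ (hτ0 k) hkT
      have e2 := hM (γ (τ k)) (q k)
      rw [norm_sub_rev (γ _)] at e2
      have e3 := norm_sub_norm_le (g (γ (τ k))) (g (q k))
      have e4 := mul_le_mul_of_nonneg_left (he.trans (hbound _ (hτ0 k) (by linarith))) hM0
      linarith
    have hn : 0 < ‖g (q k)‖ := hc.trans_le hgc
    have hh : η / ‖g (q k)‖ ^ 2 ≤ η / c ^ 2 := by gcongr
    obtain ⟨hkK, hd, hs⟩ := h.step (a := 4 * M * (η / c ^ 2)) hg hM hM0 hη hk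
      (norm_pos_iff.1 hn)
      (by
        calc 4 * M * η = 4 * M * (η / c ^ 2) * c ^ 2 := by field_simp
          _ ≤ _ := by gcongr)
      (by positivity) h2
    have hτk := hτs k
    set w := η / ‖g (q k)‖ ^ 2 with hw
    have hw0 : 0 < w := by positivity
    refine ⟨hkK, by linarith, hd.trans (by gcongr), ?_⟩
    have es : ‖q (k + 1) - q k - w • g (q k)‖ ≤ ε / 2 * w := by
      refine (pow_le_pow_iff_left₀ (norm_nonneg _) (by positivity) two_ne_zero).1 (hs.trans ?_)
      have : η / ‖g (q k)‖ = w * ‖g (q k)‖ := by rw [hw]; field_simp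
      rw [this]
      calc 5 * (4 * M * (η / c ^ 2)) * (w * ‖g (q k)‖) ^ 2
          = 5 * (4 * M * (η / c ^ 2)) * ‖g (q k)‖ ^ 2 * w ^ 2 := by ring
        _ ≤ 5 * (4 * M * (η / c ^ 2)) * G ^ 2 * w ^ 2 := by gcongr; exact hG _
        _ ≤ (ε / 2) ^ 2 * w ^ 2 := by gcongr
        _ = _ := by ring
    have ef : ‖γ (τ k + w) - γ (τ k) - w • g (γ (τ k))‖ ≤ ε / 2 * w := by
      have := (norm_sub_sub_smul_le hγ hM hM0 hG (hτ0 k)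
        (by linarith : τ k ≤ τ k + w)).2
      rw [add_sub_cancel_left] at this
      refine this.trans ?_
      have hG0 : 0 ≤ G := (norm_nonneg _).trans (hG x)
      calc M * G * w ^ 2 = M * G * w * w := by ring
        _ ≤ M * G * (η / c ^ 2) * w := by gcongr
        _ ≤ _ := by gcongr
    have eg : ‖w • (g (q k) - g (γ (τ k)))‖ ≤ w * (M * ‖q k - γ (τ k)‖) := by
      rw [norm_smul, Real.norm_of_nonneg hw0.le]
      gcongr
      exact hM _ _
    rw [hτk]
    have etri : ‖q (k + 1) - γ (τ k + w)‖ ≤ (1 + M * w) * ‖q k - γ (τ k)‖ + ε * w := by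
      have : q (k + 1) - γ (τ k + w) = (q (k + 1) - q k - w • g (q k)) +
          (q k - γ (τ k)) + w • (g (q k) - g (γ (τ k))) -
          (γ (τ k + w) - γ (τ k) - w • g (γ (τ k))) := by
        rw [smul_sub]; abel
      rw [this]
      have t1 := norm_sub_le ((q (k + 1) - q k - w • g (q k)) +
          (q k - γ (τ k)) + w • (g (q k) - g (γ (τ k))))
          (γ (τ k + w) - γ (τ k) - w • g (γ (τ k)))
      have t2 := norm_add₃_le (a := q (k + 1) - q k - w • g (q k))
          (b := q k - γ (τ k)) (c := w • (g (q k) - g (γ (τ k))))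
      linarith
    have hexp : 1 + M * w ≤ Real.exp (M * w) := by linarith [Real.add_one_le_exp (M * w)]
    have hexp1 : 1 ≤ Real.exp (M * (τ k + w)) :=
      Real.one_le_exp (mul_nonneg hM0 (add_nonneg (hτ0 k) hw0.le))
    have hτk0 := hτ0 k
    calc ‖q (k + 1) - γ (τ k + w)‖
        ≤ Real.exp (M * w) * (ε * (τ k * Real.exp (M * τ k))) + ε * w * 1 := by
          refine etri.trans ?_
          rw [mul_one]
          gcongr
      _ ≤ Real.exp (M * w) * (ε * (τ k * Real.exp (M * τ k))) +
          ε * w * Real.exp (M * (τ k + w)) := by gcongr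
      _ = _ := by rw [mul_add M, Real.exp_add]; ring
  have hind : ∀ k, (∀ j < k, τ j < T) →
      k ≤ K ∧ ‖q k - γ (τ k)‖ ≤ ε * (τ k * Real.exp (M * τ k)) := by
    intro k
    induction k with
    | zero => simp [hτ, hγ0, h.1]
    | succ k ih =>
      intro hj
      obtain ⟨hk, he⟩ := ih fun j hj' => hj j (by omega)
      obtain ⟨s1, -, -, s2⟩ := hstep k hk (hj k (by omega)) he
      exact ⟨s1, s2⟩
  have hex : ∃ n, T ≤ τ n := by
    by_contra! hcon
    have := (hind (K + 1) fun j _ => hcon j).1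
    omega
  classical
  have hlt : ∀ k < Nat.find hex, τ k < T := fun k hk => not_le.1 (Nat.find_min hex hk)
  refine ⟨Nat.find hex, (hind _ hlt).1, τ, by simp [hτ], Nat.find_spec hex, fun k hk => ?_,
    fun k hk => ⟨hτ0 k, ?_⟩⟩
  · obtain ⟨hkK, he⟩ := hind k fun j hj => hlt j (hj.trans hk)
    obtain ⟨-, s1, s2, -⟩ := hstep k hkK (hlt k hk) he
    exact ⟨hlt k hk, s1, s2⟩
  · refine (hind k fun j hj => hlt j (by omega)).2.trans (hbound _ (hτ0 k) ?_)
    cases k with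
    | zero => simp [hτ]; linarith
    | succ k =>
      obtain ⟨hkK, he⟩ := hind k fun j hj => hlt j (by omega)
      have := (hstep k hkK (hlt k (by omega)) he).2.1
      linarith [hlt k (by omega)]

end Run

lemma mem_polyline {q : ℕ → EuclideanSpace ℝ (Fin d)} {K k : ℕ} (hk : k ≤ K) :
    q k ∈ Polyline q K := by
  cases k with
  | zero => exact Or.inl rfl
  | succ k =>
    exact Or.inr (mem_biUnion (x := k) (by simpa using hk) (right_mem_segment ℝ _ _))

/-- As `η → 0`, the polygonal line connecting the points produced by Algorithm 1
started at `x` converges in Hausdorff distance to the gradient ascent line originating at `x`. -/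
theorem alg1_polyline_converges (f : EuclideanSpace ℝ (Fin d) → ℝ)
    (hf : StandingAssumptions f) (x xstar : EuclideanSpace ℝ (Fin d))
    (hmode : IsLocalMax f xstar) (γ : ℝ → EuclideanSpace ℝ (Fin d))
    (hγ : IsGradientFlow f x γ) (hlim : Tendsto γ atTop (nhds xstar)) :
    ∀ δ : ℝ, 0 < δ → ∃ η₀ > 0, ∀ η : ℝ, 0 < η → η ≤ η₀ →
      ∀ q K r, Alg1Run f x η q K r →
        hausdorffDist (Polyline q K) (γ '' Ici 0 ∪ {xstar}) ≤ δ := by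
  intro δ hδ
  obtain ⟨hC2, -, ⟨G₀, hG₀⟩, ⟨M₀, hM₀⟩, -, hmorse⟩ := hf
  obtain ⟨hγ0, hγ⟩ := hγ
  have hdf : Differentiable ℝ f := hC2.differentiable (by norm_num)
  have hdg : Differentiable ℝ (gradient f) :=
    ((InnerProductSpace.toDual ℝ
      (EuclideanSpace ℝ (Fin d))).symm.toContinuousLinearEquiv.contDiff.comp
      (hC2.fderiv_right (m := 1) (by norm_num))).differentiable (by norm_num)
  have hg : ∀ y, HasGradientAt f (gradient f y) y := fun y => (hdf y).hasGradientAt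
  obtain ⟨G, hG0, hG⟩ : ∃ G > 0, ∀ y, ‖gradient f y‖ ≤ G :=
    ⟨max G₀ 1, by positivity, fun y => (hG₀ y).trans (le_max_left _ _)⟩
  obtain ⟨M, hM0, hM⟩ : ∃ M > 0, ∀ a b, ‖gradient f a - gradient f b‖ ≤ M * ‖a - b‖ :=
    ⟨max M₀ 1, by positivity, fun a b => convex_univ.norm_image_sub_le_of_norm_fderiv_le
      (fun y _ => hdg y) (fun y _ => (hM₀ y).trans (le_max_left _ _)) trivial trivial⟩
  have hfG : ∀ a b, |f a - f b| ≤ G * ‖a - b‖ := fun a b =>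
    convex_univ.norm_image_sub_le_of_norm_hasFDerivWithin_le
      (fun y _ => (hg y).hasFDerivAt.hasFDerivWithinAt)
      (fun y _ => by rw [LinearIsometryEquiv.norm_map]; exact hG y) trivial trivial
  have hcrit : gradient f xstar = 0 := by rw [gradient, hmode.fderiv_eq_zero, map_zero]
  obtain ⟨ρ, hρ, hρδ, m, hm, hsphere⟩ := exists_sphere_le_of_isLocalMax hdf.continuous hmode
    (hdg xstar) (hmorse xstar hcrit).1 (half_pos hδ)
  -- Beyond time `T` the flow line is trapped near the mode; before `T` it has no critical point.
  obtain ⟨T, c, hT, hc, htail, hcT⟩ : ∃ T c : ℝ, 0 ≤ T ∧ 0 < c ∧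
      (∀ t, T ≤ t → dist (γ t) xstar < ρ / 2 ∧ (m + f xstar) / 2 < f (γ t)) ∧
      ∀ t, 0 ≤ t → t < T → 2 * c ≤ ‖gradient f (γ t)‖ := by
    have hev : ∀ᶠ t in atTop, dist (γ t) xstar < ρ / 2 ∧ (m + f xstar) / 2 < f (γ t) :=
      (hlim.eventually (ball_mem_nhds _ (half_pos hρ))).and
        (((hdf.continuous.tendsto xstar).comp hlim).eventually
          (lt_mem_nhds (show (m + f xstar) / 2 < f xstar by linarith)))
    obtain ⟨T₀, hT₀⟩ := eventually_atTop.1 hev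
    by_cases hz : ∃ t₀, 0 ≤ t₀ ∧ gradient f (γ t₀) = 0
    · obtain ⟨t₀, ht₀, hz⟩ := hz
      have hconst : ∀ t, 0 ≤ t → γ t = γ t₀ := fun t ht =>
        eq_of_flow_meets_zero hγ hM ht₀ hz ht
      refine ⟨0, 1, le_rfl, one_pos, fun t ht => ?_, fun t h1 h2 => absurd h2 h1.not_gt⟩
      rw [hconst t ht, ← hconst (max T₀ 0) (le_max_right _ _)]
      exact hT₀ _ (le_max_left _ _)
    · push Not at hz
      obtain ⟨s, hs, hmin⟩ := (isCompact_Icc (a := (0 : ℝ)) (b := max T₀ 0)).exists_isMinOn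
        (f := fun t => ‖gradient f (γ t)‖) ⟨0, le_rfl, le_max_right _ _⟩
        (fun t ht => ((hdg.continuous.continuousAt.comp
          (hγ t ht.1).continuousAt).norm).continuousWithinAt)
      refine ⟨max T₀ 0, ‖gradient f (γ s)‖ / 2, le_max_right _ _,
        half_pos (norm_pos_iff.2 (hz s hs.1)),
        fun t ht => hT₀ t ((le_max_left _ _).trans ht), fun t h1 h2 => ?_⟩
      rw [mul_div_cancel₀ _ two_ne_zero]
      exact hmin ⟨h1, h2.le⟩
  -- The tolerance for the shadowing error.
  obtain ⟨e, he, hec, heρ, hem⟩ : ∃ e > 0, M * e ≤ c ∧ e ≤ ρ / 2 ∧ G * e ≤ (f xstar - m) / 2 := by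
    refine ⟨min (c / M) (min (ρ / 2) ((f xstar - m) / 2 / G)), ?_, ?_, ?_, ?_⟩
    · have : 0 < f xstar - m := by linarith
      positivity
    · rw [← le_div_iff₀' hM0]; exact min_le_left _ _
    · exact (min_le_right _ _).trans (min_le_left _ _)
    · rw [← le_div_iff₀' hG0]; exact (min_le_right _ _).trans (min_le_right _ _)
  set A := (T + 1) * Real.exp (M * (T + 1)) with hA
  have hA0 : 0 < A := by positivity
  have heA : e / A * A = e := div_mul_cancel₀ _ hA0.ne'
  set ε := e / A with hε
  have hε0 : 0 < ε := by positivity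
  have hsmall : ∀ B b : ℝ, 0 < b → ∀ᶠ η in 𝓝 (0 : ℝ), B * η < b := fun B b hb => by
    have : Tendsto (fun η : ℝ => B * η) (𝓝 0) (𝓝 (B * 0)) := tendsto_id.const_mul B
    rw [mul_zero] at this
    exact this.eventually (gt_mem_nhds hb)
  obtain ⟨r₀, hr₀, hη₀⟩ := Metric.eventually_nhds_iff.1
    ((hsmall (1 / c ^ 2) 1 one_pos).and <|
    (hsmall (4 * M * (1 / c ^ 2)) (1 / 2) (by norm_num)).and <|
    (hsmall (5 * (4 * M * (1 / c ^ 2)) * G ^ 2) ((ε / 2) ^ 2) (by positivity)).and <|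
    (hsmall (M * G * (1 / c ^ 2)) (ε / 2) (by positivity)).and <|
    (hsmall (G * (1 / c ^ 2)) (δ / 2) (by positivity)).and
    (hsmall (2 * (1 / c)) (δ / 2) (by positivity)))
  refine ⟨r₀ / 2, half_pos hr₀, fun η hη hηr q K r h => ?_⟩
  obtain ⟨b1, b2, b3, b4, b5, b6⟩ := hη₀ (y := η) (by
    rw [Real.dist_0_eq_abs, abs_of_pos hη]; linarith)
  obtain ⟨N, hNK, τ, hτ0, hTτ, hstep, hshadow⟩ := h.exists_shadowing hg hM hM0.le hG hη hγ0 hγ hc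
    hT hcT hε0.le (by rw [← hA, heA]; exact hec)
    (b1.le.trans' (by ring_nf; rfl)) (b2.le.trans' (by ring_nf; rfl))
    (b3.le.trans' (by ring_nf; rfl)) (b4.le.trans' (by ring_nf; rfl))
  rw [← hA, heA] at hshadow
  have hqN : q N ∈ ball xstar ρ := by
    have h1 := (hshadow N le_rfl).2
    rw [← dist_eq_norm] at h1
    have h2 := (htail _ hTτ).1
    have h3 := dist_triangle (q N) (γ (τ N)) xstar
    rw [mem_ball]
    linarith
  have hball : ∀ k, N ≤ k → k ≤ K → q k ∈ ball xstar ρ := by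
    intro k
    refine h.mem_ball hη.le (fun y hy => (hsphere y hy).trans_lt ?_) hqN
    rw [← h.apply_eq hNK]
    have h1 := (abs_le.1 (hfG (q N) (γ (τ N)))).1
    have h2 := mul_le_mul_of_nonneg_left (hshadow N le_rfl).2 hG0.le
    have h3 := (htail _ hTτ).2
    linarith
  refine hausdorffDist_le_of_mem_dist hδ.le ?_ ?_
  · rintro y (rfl | hy)
    · exact ⟨γ 0, Or.inl ⟨0, self_mem_Ici, rfl⟩, by rw [h.1, hγ0, dist_self]; exact hδ.le⟩
    · simp only [Finset.mem_range, mem_iUnion, exists_prop] at hy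
      obtain ⟨k, hk, hy⟩ := hy
      rcases lt_or_ge k N with hkN | hkN
      · refine ⟨γ (τ k), Or.inl ⟨τ k, (hshadow k hkN.le).1, rfl⟩, ?_⟩
        have h1 := (hshadow k hkN.le).2
        rw [← dist_eq_norm] at h1
        have h2 := (hstep k hkN).2.2
        have h3 := norm_sub_le_of_mem_segment hy
        rw [← dist_eq_norm] at h3
        have h4 := dist_triangle y (q k) (γ (τ k))
        have h5 : 2 * (η / c) = 2 * (1 / c) * η := by ring
        linarith
      · have h1 := (convex_ball xstar ρ).segment_subset (hball k hkN hk.le)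
          (hball (k + 1) (by omega) hk) hy
        exact ⟨xstar, Or.inr rfl, by rw [mem_ball] at h1; linarith⟩
  · have hnear : ∀ z, dist z xstar < ρ / 2 → ∃ y ∈ Polyline q K, dist z y ≤ δ := fun z hz => by
      refine ⟨q N, mem_polyline hNK, ?_⟩
      have := dist_triangle_right z (q N) xstar
      rw [mem_ball] at hqN
      linarith
    rintro y (⟨t, ht, rfl⟩ | rfl)
    · rcases le_or_gt T t with hTt | htT
      · exact hnear _ (htail t hTt).1
      · classical
        have hex : ∃ j, t < τ j := ⟨N, htT.trans_le hTτ⟩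
        have hj := Nat.find_spec hex
        have hjN : Nat.find hex ≤ N := Nat.find_min' hex (htT.trans_le hTτ)
        have hjmin : ∀ k < Nat.find hex, τ k ≤ t := fun k hk => not_lt.1 (Nat.find_min hex hk)
        generalize Nat.find hex = j at hj hjN hjmin
        cases j with
        | zero => rw [hτ0] at hj; exact absurd hj (not_lt.2 ht)
        | succ k =>
          refine ⟨q k, mem_polyline (by omega), ?_⟩
          have hkt := hjmin k (by omega)
          obtain ⟨-, h1, -⟩ := hstep k (by omega)
          obtain ⟨h2, h3⟩ := hshadow k (by omega)
          have h4 := (norm_sub_sub_smul_le hγ hM hM0.le hG h2 hkt).1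
          have h5 : G * (t - τ k) ≤ G * (η / c ^ 2) := by gcongr; linarith
          have h6 : G * (1 / c ^ 2) * η = G * (η / c ^ 2) := by ring
          have h7 := dist_triangle_right (γ t) (q k) (γ (τ k))
          rw [dist_eq_norm (γ t) (γ _), dist_eq_norm (q k)] at h7
          linarith
    · exact hnear _ (by simpa using hρ)
end
end

section
/- Let f : ℝ^d → ℝ satisfy the standing assumptions, and let x lie in the basin of attraction of a mode x_* of f. For ε > 0 let (q_k) be the sequence produced by Algorithm 2 started at x with spatial step ε (q_0 = x, t_k = max{f(y) : ‖y − q_{k−1}‖ ≤ ε}, and q_k a metric projection of q_{k−1} onto L_{t_k}). Then, as ε → 0, the polygonal line obtained by connecting consecutive points of the sequence (q_k) converges, in Hausdorff distance, to the gradient ascent line {γ_x(t) : t ≥ 0} ∪ {x_*} originating at x. -/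
open Metric Set Filter Topology MeasureTheory

noncomputable section

variable {d : ℕ}

/-- A complete run of Algorithm 2 with spatial step `ε`, starting point `x`:
`q 0 = x`; at each step, `q (k+1)` is a metric projection of `q k` onto the level set at the
highest level achieved within distance `ε` of `q k`; the algorithm stops at the first step `K`
where the projection equals the current point, returning that point. -/
def Alg2Run (f : EuclideanSpace ℝ (Fin d) → ℝ) (x : EuclideanSpace ℝ (Fin d)) (ε : ℝ)
    (q : ℕ → EuclideanSpace ℝ (Fin d)) (K : ℕ) : Prop :=
  q 0 = x ∧
  (∀ k ≤ K,
    IsProjOn {y | f y = sSup (f '' closedBall (q k) ε)} (q k) (q (k + 1))) ∧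
  (∀ k < K, q (k + 1) ≠ q k) ∧
  q (K + 1) = q K

section GradientFlow

variable {E : Type*} [NormedAddCommGroup E] [InnerProductSpace ℝ E]

/-- First-order Taylor estimate for a function with Lipschitz gradient. -/
lemma abs_sub_sub_inner_gradient_le_s3 [CompleteSpace E] {f : E → ℝ} {M : ℝ}
    (hf : Differentiable ℝ f) (hM : 0 ≤ M)
    (hlip : ∀ a b, ‖gradient f b - gradient f a‖ ≤ M * ‖b - a‖) (a b : E) :
    |f b - f a - inner ℝ (gradient f a) (b - a)| ≤ M * ‖b - a‖ ^ 2 := by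
  have h := (convex_closedBall a ‖b - a‖).norm_image_sub_le_of_norm_fderiv_le'
    (f := f) (φ := fderiv ℝ f a) (C := M * ‖b - a‖) (𝕜 := ℝ) (x := a) (y := b)
    (fun y _ => hf y) ?_ (mem_closedBall_self (norm_nonneg _))
    (by rw [mem_closedBall, dist_eq_norm])
  · rw [inner_gradient_left, ← Real.norm_eq_abs]
    exact h.trans_eq (by ring)
  · intro y hy
    rw [mem_closedBall, dist_eq_norm] at hy
    rw [← toDual_gradient, ← toDual_gradient, ← map_sub, LinearIsometryEquiv.norm_map]
    exact (hlip a y).trans (mul_le_mul_of_nonneg_left hy hM)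

/-- A point of the `ε`-ball around `q` whose value dominates the one at the end of the normalized
gradient step is close to the end of that step. -/
lemma norm_sub_normalized_step_sq_le [CompleteSpace E] {f : E → ℝ} {M ε : ℝ}
    (hf : Differentiable ℝ f) (hM : 0 ≤ M)
    (hlip : ∀ a b, ‖gradient f b - gradient f a‖ ≤ M * ‖b - a‖) {q p : E} (hε : 0 ≤ ε)
    (hg : 0 < ‖gradient f q‖) (hp : ‖p - q‖ ≤ ε)
    (hmax : f (q + (ε / ‖gradient f q‖) • gradient f q) ≤ f p) :
    ‖p - q - (ε / ‖gradient f q‖) • gradient f q‖ ^ 2 ≤ 4 * M * ε ^ 3 / ‖gradient f q‖ := by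
  set g := gradient f q with hgdef
  have hn : ‖(ε / ‖g‖) • g‖ = ε := by
    rw [norm_smul, Real.norm_of_nonneg (by positivity)]
    field_simp
  have h1 := abs_sub_sub_inner_gradient_le_s3 hf hM hlip q p
  have h2 := abs_sub_sub_inner_gradient_le_s3 hf hM hlip q (q + (ε / ‖g‖) • g)
  rw [add_sub_cancel_left, hn, ← hgdef, real_inner_smul_right, real_inner_self_eq_norm_sq] at h2
  rw [← hgdef] at h1
  have hpq : ‖p - q‖ ^ 2 ≤ ε ^ 2 := by gcongr
  have hMpq : M * ‖p - q‖ ^ 2 ≤ M * ε ^ 2 := by gcongr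
  have hεg : ε / ‖g‖ * ‖g‖ ^ 2 = ε * ‖g‖ := by field_simp
  rw [hεg] at h2
  have h3 : ε * ‖g‖ - 2 * (M * ε ^ 2) ≤ inner ℝ g (p - q) := by
    have := abs_le.1 h1
    have := abs_le.1 h2
    linarith
  have h4 : ε / ‖g‖ * (ε * ‖g‖ - 2 * (M * ε ^ 2)) ≤ ε / ‖g‖ * inner ℝ g (p - q) := by gcongr
  have h5 : ε / ‖g‖ * (ε * ‖g‖ - 2 * (M * ε ^ 2)) = ε ^ 2 - 4 * M * ε ^ 3 / ‖g‖ / 2 := by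
    field_simp; ring
  rw [norm_sub_sq_real, hn, real_inner_smul_right, real_inner_comm]
  linarith

lemma norm_sub_euler_step_le [CompleteSpace E] {f : E → ℝ} {M G ε : ℝ}
    (hf : Differentiable ℝ f) (hM : 0 ≤ M)
    (hlip : ∀ a b, ‖gradient f b - gradient f a‖ ≤ M * ‖b - a‖) (hG : ∀ a, ‖gradient f a‖ ≤ G)
    {q p : E} (hε : 0 ≤ ε) (hg : 0 < ‖gradient f q‖) (hp : ‖p - q‖ ≤ ε)
    (hmax : f (q + (ε / ‖gradient f q‖) • gradient f q) ≤ f p) :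
    ‖p - q - (ε / ‖gradient f q‖) • gradient f q‖
      ≤ ε / ‖gradient f q‖ * √(4 * M * G * ε) := by
  have hG0 : 0 ≤ G := (norm_nonneg _).trans (hG q)
  refine abs_le_of_sq_le_sq' ?_ (by positivity) |>.2
  refine (norm_sub_normalized_step_sq_le hf hM hlip hε hg hp hmax).trans ?_
  rw [mul_pow, Real.sq_sqrt (by positivity)]
  have : 4 * M * ε ^ 3 / ‖gradient f q‖
      = (ε / ‖gradient f q‖) ^ 2 * (4 * M * ‖gradient f q‖ * ε) := by field_simp
  rw [this]
  gcongr
  exact hG q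

lemma ne_of_maximal_step [CompleteSpace E] {f : E → ℝ} {M ε : ℝ}
    (hf : Differentiable ℝ f) (hM : 0 ≤ M)
    (hlip : ∀ a b, ‖gradient f b - gradient f a‖ ≤ M * ‖b - a‖)
    {q p : E} (hε : 0 < ε) (hg : 4 * M * ε < ‖gradient f q‖) (hp : ‖p - q‖ ≤ ε)
    (hmax : f (q + (ε / ‖gradient f q‖) • gradient f q) ≤ f p) : p ≠ q := by
  rintro rfl
  have hg0 : 0 < ‖gradient f p‖ := lt_of_le_of_lt (by positivity) hg
  have h := norm_sub_normalized_step_sq_le hf hM hlip hε.le hg0 hp hmax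
  rw [sub_self, zero_sub, norm_neg, norm_smul, Real.norm_of_nonneg (by positivity),
    div_mul_cancel₀ _ hg0.ne', le_div_iff₀ hg0] at h
  have : ε ^ 2 * (4 * M * ε) < ε ^ 2 * ‖gradient f p‖ := by gcongr
  nlinarith

variable {v : E → E} {γ : ℝ → E} {M G : ℝ}

lemma norm_sub_le_of_bounded_velocity (hγ : ∀ t : ℝ, 0 ≤ t → HasDerivAt γ (v (γ t)) t)
    (hG : ∀ a, ‖v a‖ ≤ G) {s t : ℝ} (hs : 0 ≤ s) (hst : s ≤ t) :
    ‖γ t - γ s‖ ≤ G * (t - s) :=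
  norm_image_sub_le_of_norm_deriv_le_segment' (f' := fun u => v (γ u)) (a := s) (b := t)
    (fun u hu => (hγ u (hs.trans hu.1)).hasDerivWithinAt) (fun _ _ => hG _) t ⟨hst, le_rfl⟩

lemma norm_sub_sub_smul_velocity_le (hγ : ∀ t : ℝ, 0 ≤ t → HasDerivAt γ (v (γ t)) t)
    (hM : 0 ≤ M) (hlip : ∀ a b, ‖v b - v a‖ ≤ M * ‖b - a‖) (hG : ∀ a, ‖v a‖ ≤ G)
    {t h : ℝ} (ht : 0 ≤ t) (hh : 0 ≤ h) :
    ‖γ (t + h) - γ t - h • v (γ t)‖ ≤ M * G * h * h := by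
  have hG0 : 0 ≤ G := (norm_nonneg _).trans (hG (γ 0))
  have := norm_image_sub_le_of_norm_deriv_le_segment' (f := fun u => γ u - (u - t) • v (γ t))
    (f' := fun u => v (γ u) - v (γ t)) (a := t) (b := t + h) (C := M * G * h)
    (fun u hu => by
      have h1 := (hγ u (ht.trans hu.1)).sub
        ((((hasDerivAt_id u).sub_const t).smul_const (v (γ t))))
      rw [one_smul] at h1
      exact h1.hasDerivWithinAt)
    (fun u hu => by
      refine (hlip _ _).trans ?_
      have h2 := norm_sub_le_of_bounded_velocity hγ hG ht hu.1
      have h3 : G * (u - t) ≤ G * h := by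
        gcongr
        linarith [hu.2]
      calc M * ‖γ u - γ t‖ ≤ M * (G * h) := by gcongr; exact h2.trans h3
        _ = _ := by ring) (t + h) ⟨by linarith, le_rfl⟩
  simpa [sub_right_comm] using this

/-- Propagation of the error of a perturbed Euler scheme over one step. -/
lemma euler_error_step (hγ : ∀ t : ℝ, 0 ≤ t → HasDerivAt γ (v (γ t)) t)
    (hM : 0 ≤ M) (hlip : ∀ a b, ‖v b - v a‖ ≤ M * ‖b - a‖) (hG : ∀ a, ‖v a‖ ≤ G)
    {t h κ η : ℝ} (ht : 0 ≤ t) (hh : 0 ≤ h) (hη : 0 ≤ η) (hκ : κ + M * G * h ≤ η) {q p : E}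
    (hq : ‖q - γ t‖ ≤ η * t * Real.exp (M * t)) (hp : ‖p - q - h • v q‖ ≤ h * κ) :
    ‖p - γ (t + h)‖ ≤ η * (t + h) * Real.exp (M * (t + h)) := by
  have h1 := norm_sub_sub_smul_velocity_le hγ hM hlip hG ht hh
  have hdecomp : p - γ (t + h) = (p - q - h • v q) + (q - γ t) + h • (v q - v (γ t))
      - (γ (t + h) - γ t - h • v (γ t)) := by
    rw [smul_sub]; abel
  have h2 : ‖h • (v q - v (γ t))‖ ≤ h * (M * ‖q - γ t‖) := by
    rw [norm_smul, Real.norm_of_nonneg hh]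
    gcongr
    exact hlip _ _
  have h3 : ‖p - γ (t + h)‖ ≤ (1 + M * h) * ‖q - γ t‖ + h * η := by
    rw [hdecomp]
    refine (norm_sub_le _ _).trans ?_
    have := norm_add₃_le (a := p - q - h • v q) (b := q - γ t) (c := h • (v q - v (γ t)))
    have h4 : h * (κ + M * G * h) ≤ h * η := by gcongr
    linarith
  have h5 : 1 + M * h ≤ Real.exp (M * h) := by
    have := Real.add_one_le_exp (M * h)
    linarith
  have h6 : (1 + M * h) * ‖q - γ t‖ ≤ Real.exp (M * h) * (η * t * Real.exp (M * t)) := by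
    gcongr
  have h7 : h * η ≤ h * η * Real.exp (M * (t + h)) :=
    le_mul_of_one_le_right (by positivity) (Real.one_le_exp (by positivity))
  have h8 : Real.exp (M * (t + h)) = Real.exp (M * t) * Real.exp (M * h) := by
    rw [← Real.exp_add]; ring_nf
  refine h3.trans ((add_le_add h6 h7).trans_eq ?_)
  rw [h8]; ring

/-- A solution of an autonomous Lipschitz equation passing through an equilibrium is constant. -/
lemma eq_of_velocity_eq_zero (hγ : ∀ t : ℝ, 0 ≤ t → HasDerivAt γ (v (γ t)) t)
    (hM : 0 ≤ M) (hlip : ∀ a b, ‖v b - v a‖ ≤ M * ‖b - a‖) {t : ℝ} (ht : 0 ≤ t)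
    (h0 : v (γ t) = 0) {s : ℝ} (hs : 0 ≤ s) : γ s = γ t := by
  have hL : LipschitzWith ⟨M, hM⟩ v := LipschitzWith.of_dist_le_mul fun a b => by
    rw [dist_eq_norm, dist_eq_norm]; exact hlip b a
  have hc : ∀ a b : ℝ, 0 ≤ a → ContinuousOn γ (Icc a b) := fun a b ha u hu =>
    (hγ u (ha.trans hu.1)).continuousAt.continuousWithinAt
  have hconst : ∀ (u : ℝ) (S : Set ℝ), HasDerivWithinAt (fun _ : ℝ => γ t) (v (γ t)) S u :=
    fun u S => by rw [h0]; exact hasDerivWithinAt_const _ _ _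
  rcases le_total s t with hst | hst
  · exact ODE_solution_unique_of_mem_Icc_left (v := fun _ => v) (s := fun _ => univ) (a := 0)
      (b := t) (g := fun _ => γ t) (fun _ _ => hL.lipschitzOnWith) (hc 0 t le_rfl)
      (fun u hu => (hγ u hu.1.le).hasDerivWithinAt) (fun _ _ => trivial) continuousOn_const
      (fun u _ => hconst u _) (fun _ _ => trivial) rfl ⟨hs, hst⟩
  · exact ODE_solution_unique (v := fun _ => v) (a := t) (b := s) (g := fun _ => γ t)
      (fun _ => hL) (hc t s ht) (fun u hu => (hγ u (ht.trans hu.1)).hasDerivWithinAt)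
      continuousOn_const (fun u _ => hconst u _) rfl ⟨hst, le_rfl⟩

/-- A convergent trajectory splits into an initial phase with speed bounded below and a final
phase near the limit. -/
lemma exists_time_speed_ge (hγ : ∀ t : ℝ, 0 ≤ t → HasDerivAt γ (v (γ t)) t)
    (hM : 0 ≤ M) (hlip : ∀ a b, ‖v b - v a‖ ≤ M * ‖b - a‖) {z : E}
    (hlim : Tendsto γ atTop (nhds z)) {ρ : ℝ} (hρ : 0 < ρ) :
    ∃ T, 0 ≤ T ∧ (∀ t, T ≤ t → dist (γ t) z < ρ) ∧
      ∃ c, 0 < c ∧ ∀ t, 0 ≤ t → t < T → c ≤ ‖v (γ t)‖ := by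
  by_cases hcrit : ∃ t, 0 ≤ t ∧ v (γ t) = 0
  · obtain ⟨t, ht, h0⟩ := hcrit
    have hall : ∀ s, 0 ≤ s → γ s = γ t := fun s hs =>
      eq_of_velocity_eq_zero hγ hM hlip ht h0 hs
    have hz : z = γ t := tendsto_nhds_unique hlim <|
      tendsto_const_nhds.congr' <| (eventually_ge_atTop 0).mono fun s hs => (hall s hs).symm
    refine ⟨0, le_rfl, fun s hs => ?_, 1, one_pos, fun s hs hs' => absurd hs hs'.not_ge⟩
    rw [hall s hs, hz, dist_self]
    exact hρ
  · push Not at hcrit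
    obtain ⟨T, hT⟩ := eventually_atTop.1 (Metric.tendsto_nhds.1 hlim ρ hρ)
    refine ⟨max T 0, le_max_right _ _, fun t ht => hT t ((le_max_left _ _).trans ht), ?_⟩
    have hv : Continuous v := (LipschitzWith.of_dist_le_mul (K := ⟨M, hM⟩) fun a b => by
      rw [dist_eq_norm, dist_eq_norm]; exact hlip b a).continuous
    have hc : ContinuousOn (fun t => ‖v (γ t)‖) (Icc 0 (max T 0)) := fun u hu =>
      ((hv.continuousAt.comp (hγ u hu.1).continuousAt).norm).continuousWithinAt
    obtain ⟨u, hu, hmin⟩ := isCompact_Icc.exists_isMinOn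
      (nonempty_Icc.2 (le_max_right T 0)) hc
    exact ⟨_, norm_pos_iff.2 (hcrit u hu.1), fun t ht htT => hmin ⟨ht, htT.le⟩⟩

end GradientFlow

section LocalMax

variable {E : Type*} [NormedAddCommGroup E] [InnerProductSpace ℝ E] [FiniteDimensional ℝ E]

/-- A local maximum with nonsingular Hessian is strict. -/
lemma IsLocalMax.eventually_lt_of_injective_hessian [CompleteSpace E] {f : E → ℝ} {z : E}
    (hmax : IsLocalMax f z) (hdiff : DifferentiableAt ℝ (gradient f) z)
    (hinj : Function.Injective (fderiv ℝ (gradient f) z)) :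
    ∀ᶠ y in 𝓝[≠] z, f y < f z := by
  obtain ⟨C, -, hC⟩ := LinearMap.exists_antilipschitzWith (fderiv ℝ (gradient f) z).toLinearMap
    (LinearMap.ker_eq_bot.2 hinj)
  have h0 := hdiff.hasFDerivAt.eventually_ne (c := 0) ⟨C, hC⟩
  have hloc := (eventually_eventually_nhds.2 hmax).filter_mono (nhdsWithin_le_nhds (s := {z}ᶜ))
  filter_upwards [h0, hloc] with y hy hy'
  refine lt_of_le_of_ne hy'.self_of_nhds fun heq => hy ?_
  have : IsLocalMax f y := hy'.mono fun w hw => hw.trans_eq heq.symm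
  rw [gradient, this.fderiv_eq_zero, map_zero]

/-- Around a strict local maximum there is a shell on which the function stays below a level
strictly less than the maximum. -/
lemma exists_shell_le {f : E → ℝ} {z : E} (hf : Continuous f)
    (hmax : ∀ᶠ y in 𝓝[≠] z, f y < f z) {δ : ℝ} (hδ : 0 < δ) :
    ∃ r m, 0 < r ∧ r ≤ δ ∧ m < f z ∧ ∀ y, r / 2 ≤ dist y z → dist y z ≤ r → f y ≤ m := by
  rw [eventually_nhdsWithin_iff, Metric.eventually_nhds_iff] at hmax
  obtain ⟨s, hs, hlt⟩ := hmax
  obtain ⟨r, hr, hrδ⟩ := exists_between (lt_min hs hδ)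
  rw [lt_min_iff] at hrδ
  set A : Set E := closedBall z r ∩ {y | r / 2 ≤ dist y z} with hA
  have hAc : IsCompact A := (isCompact_closedBall z r).inter_right
    (isClosed_le continuous_const (continuous_id.dist continuous_const))
  rcases A.eq_empty_or_nonempty with hempty | hne
  · refine ⟨r, f z - 1, hr, hrδ.2.le, by linarith, fun y h1 h2 => ?_⟩
    have hy : y ∈ A := ⟨h2, h1⟩
    rw [hempty] at hy
    exact hy.elim
  · obtain ⟨y₀, hy₀, hmaxon⟩ := hAc.exists_isMaxOn hne hf.continuousOn
    refine ⟨r, f y₀, hr, hrδ.2.le, hlt (lt_of_le_of_lt hy₀.1 hrδ.1) ?_,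
      fun y h1 h2 => hmaxon ⟨h2, h1⟩⟩
    intro heq
    have : r / 2 ≤ dist y₀ z := hy₀.2
    rw [heq, dist_self] at this
    linarith

end LocalMax

lemma IsProjOn.dist_le_and_le {f : EuclideanSpace ℝ (Fin d) → ℝ} (hf : Continuous f) {ε : ℝ}
    (hε : 0 ≤ ε) {q p : EuclideanSpace ℝ (Fin d)}
    (h : IsProjOn {y | f y = sSup (f '' closedBall q ε)} q p) :
    ‖p - q‖ ≤ ε ∧ ∀ y, ‖y - q‖ ≤ ε → f y ≤ f p := by
  have hc := isCompact_closedBall q ε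
  obtain ⟨y, hy, hsup, hmax⟩ := hc.exists_sSup_image_eq_and_ge
    ⟨q, mem_closedBall_self hε⟩ hf.continuousOn
  have hp : f p = sSup (f '' closedBall q ε) := h.1
  refine ⟨?_, fun w hw => ?_⟩
  · have h1 : infDist q {y | f y = sSup (f '' closedBall q ε)} ≤ dist q y :=
      infDist_le_dist_of_mem hsup.symm
    rw [← dist_eq_norm, dist_comm, h.2]
    exact h1.trans (by rw [dist_comm]; exact hy)
  · rw [hp, hsup]
    exact hmax w (by rwa [mem_closedBall, dist_eq_norm])

/-- Maximal steps of length at most `ε` follow the gradient flow for as long as the speed of the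
flow line is bounded below, and such an iteration cannot become stationary before that. -/
lemma exists_shadowing_times {E : Type*} [NormedAddCommGroup E] [InnerProductSpace ℝ E]
    [CompleteSpace E] {f : E → ℝ} {γ : ℝ → E} {M G c T ε τ : ℝ} (hf : Differentiable ℝ f)
    (hM : 0 ≤ M) (hlip : ∀ a b, ‖gradient f b - gradient f a‖ ≤ M * ‖b - a‖)
    (hG : ∀ a, ‖gradient f a‖ ≤ G)
    (hγ : ∀ t : ℝ, 0 ≤ t → HasDerivAt γ (gradient f (γ t)) t)
    (hc : 0 < c) (hT : 0 ≤ T) (hspeed : ∀ t, 0 ≤ t → t < T → c ≤ ‖gradient f (γ t)‖)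
    (hε : 0 < ε) (hMτ : M * τ ≤ c / 2) (hMε : 8 * M * ε < c) (hεc : 2 * ε / c ≤ 1)
    (hτ : (√(4 * M * G * ε) + M * G * (2 * ε / c)) * (T + 1) * Real.exp (M * (T + 1)) ≤ τ)
    {q : ℕ → E} {K : ℕ} (hq0 : q 0 = γ 0)
    (hstep : ∀ k ≤ K, ‖q (k + 1) - q k‖ ≤ ε ∧ ∀ y, ‖y - q k‖ ≤ ε → f y ≤ f (q (k + 1)))
    (hend : q (K + 1) = q K) :
    ∃ n ≤ K, ∃ t : ℕ → ℝ, t 0 = 0 ∧ T ≤ t n ∧ (∀ k ≤ n, 0 ≤ t k ∧ ‖q k - γ (t k)‖ ≤ τ) ∧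
      ∀ k < n, t k < T ∧ t (k + 1) ≤ t k + 2 * ε / c := by
  have hG0 : 0 ≤ G := (norm_nonneg _).trans (hG (γ 0))
  set η := √(4 * M * G * ε) + M * G * (2 * ε / c)
  have hη0 : 0 ≤ η := by positivity
  set t : ℕ → ℝ := fun k => ∑ i ∈ Finset.range k, ε / ‖gradient f (q i)‖ with ht
  have ht0 : ∀ k, 0 ≤ t k := fun k => Finset.sum_nonneg fun i _ => by positivity
  have htsucc : ∀ k, t (k + 1) = t k + ε / ‖gradient f (q k)‖ := fun k =>
    Finset.sum_range_succ _ _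
  have hbound : ∀ k, t k ≤ T + 1 → ‖q k - γ (t k)‖ ≤ η * t k * Real.exp (M * t k) →
      ‖q k - γ (t k)‖ ≤ τ := by
    intro k hk h
    refine h.trans (le_trans ?_ hτ)
    have := ht0 k
    gcongr
  have hgrad : ∀ k, t k < T → ‖q k - γ (t k)‖ ≤ τ → c / 2 ≤ ‖gradient f (q k)‖ := by
    intro k hk h
    have h1 := hspeed (t k) (ht0 k) hk
    have h2 := hlip (q k) (γ (t k))
    have h3 : M * ‖γ (t k) - q k‖ ≤ M * τ := by
      rw [norm_sub_rev]; gcongr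
    have h4 := norm_sub_norm_le (gradient f (γ (t k))) (gradient f (q k))
    linarith
  have hadm : ∀ k ≤ K, 0 < ‖gradient f (q k)‖ →
      f (q k + (ε / ‖gradient f (q k)‖) • gradient f (q k)) ≤ f (q (k + 1)) := by
    intro k hk hpos
    refine (hstep k hk).2 _ ?_
    rw [add_sub_cancel_left, norm_smul, Real.norm_of_nonneg (by positivity),
      div_mul_cancel₀ _ hpos.ne']
  have hle : ∀ k, c / 2 ≤ ‖gradient f (q k)‖ → ε / ‖gradient f (q k)‖ ≤ 2 * ε / c := by
    intro k hk
    calc ε / ‖gradient f (q k)‖ ≤ ε / (c / 2) := by gcongr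
      _ = 2 * ε / c := by field_simp
  have hinv : ∀ k ≤ K + 1, (∀ j < k, t j < T) →
      t k ≤ T + 1 ∧ ‖q k - γ (t k)‖ ≤ η * t k * Real.exp (M * t k) := by
    intro k
    induction k with
    | zero =>
      intro _ _
      have : t 0 = 0 := Finset.sum_range_zero _
      rw [this, hq0]
      simp only [sub_self, norm_zero, mul_zero, zero_mul]
      exact ⟨by linarith, le_rfl⟩
    | succ k ih =>
      intro hk hlt
      obtain ⟨h1, h2⟩ := ih (by omega) fun j hj => hlt j (by omega)
      have hkT := hlt k (by omega)
      have hg := hgrad k hkT (hbound k h1 h2)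
      have hpos : 0 < ‖gradient f (q k)‖ := lt_of_lt_of_le (by positivity) hg
      have hkK : k ≤ K := by omega
      rw [htsucc]
      refine ⟨by linarith [hle k hg], ?_⟩
      refine euler_error_step (κ := √(4 * M * G * ε)) hγ hM hlip hG (ht0 k) (by positivity) hη0
        ?_ h2 (norm_sub_euler_step_le hf hM hlip hG hε.le hpos (hstep k hkK).1 (hadm k hkK hpos))
      exact add_le_add le_rfl (mul_le_mul_of_nonneg_left (hle k hg) (by positivity))
  have hex : ∃ n, n ≤ K ∧ T ≤ t n := by
    by_contra! hcon
    obtain ⟨h1, h2⟩ := hinv K (by omega) fun j hj => hcon j hj.le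
    have hg := hgrad K (hcon K le_rfl) (hbound K h1 h2)
    have hpos : 0 < ‖gradient f (q K)‖ := lt_of_lt_of_le (by positivity) hg
    exact ne_of_maximal_step hf hM hlip hε (by linarith) (hstep K le_rfl).1
      (hadm K le_rfl hpos) hend
  classical
  obtain ⟨hnK, hnT⟩ := Nat.find_spec hex
  have hlt : ∀ j < Nat.find hex, t j < T := fun j hj =>
    not_le.1 fun h => Nat.find_min hex hj ⟨hj.le.trans hnK, h⟩
  have hclose : ∀ k ≤ Nat.find hex, ‖q k - γ (t k)‖ ≤ τ := fun k hk => by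
    obtain ⟨h1, h2⟩ := hinv k (by omega) fun j hj => hlt j (by omega)
    exact hbound k h1 h2
  refine ⟨Nat.find hex, hnK, t, Finset.sum_range_zero _, hnT,
    fun k hk => ⟨ht0 k, hclose k hk⟩, fun k hk => ⟨hlt k hk, ?_⟩⟩
  rw [htsucc]
  linarith [hle k (hgrad k (hlt k hk) (hclose k hk.le))]

lemma StandingAssumptions.contDiff_gradient {f : EuclideanSpace ℝ (Fin d) → ℝ}
    (hf : StandingAssumptions f) : ContDiff ℝ 1 (gradient f) :=
  (InnerProductSpace.toDual ℝ _).symm.contDiff.comp (hf.1.fderiv_right (by norm_num))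

lemma StandingAssumptions.exists_lipschitz_gradient {f : EuclideanSpace ℝ (Fin d) → ℝ}
    (hf : StandingAssumptions f) :
    ∃ M, 0 ≤ M ∧ ∀ a b, ‖gradient f b - gradient f a‖ ≤ M * ‖b - a‖ := by
  obtain ⟨M, hM⟩ := hf.2.2.2.1
  refine ⟨M, (norm_nonneg _).trans (hM 0), fun a b => ?_⟩
  exact convex_univ.norm_image_sub_le_of_norm_fderiv_le (𝕜 := ℝ)
    (fun y _ => hf.contDiff_gradient.differentiable one_ne_zero y)
    (fun y _ => hM y) (mem_univ a) (mem_univ b)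

/-- The superlevel set inside a shell of low values is invariant under short ascending steps. -/
lemma shell_trap {X : Type*} [PseudoMetricSpace X] {f : X → ℝ} {z : X} {r m ε : ℝ}
    (hshell : ∀ y, r / 2 ≤ dist y z → dist y z ≤ r → f y ≤ m) (hε : ε ≤ r / 2)
    {q : ℕ → X} {n N : ℕ}
    (hstep : ∀ k < N, dist (q (k + 1)) (q k) ≤ ε ∧ f (q k) ≤ f (q (k + 1)))
    (hn : dist (q n) z ≤ r) (hfn : m < f (q n)) :
    ∀ k, n ≤ k → k ≤ N → dist (q k) z ≤ r := by
  suffices ∀ k, n ≤ k → k ≤ N → dist (q k) z ≤ r ∧ m < f (q k) from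
    fun k h1 h2 => (this k h1 h2).1
  intro k hk
  induction k, hk using Nat.le_induction with
  | base => exact fun _ => ⟨hn, hfn⟩
  | succ k hk ih =>
    intro hkN
    obtain ⟨h1, h2⟩ := ih (by omega)
    obtain ⟨h3, h4⟩ := hstep k (by omega)
    have h5 : dist (q k) z < r / 2 := not_le.1 fun h => (hshell _ h h1).not_gt h2
    exact ⟨by linarith [dist_triangle (q (k + 1)) (q k) z], h2.trans_le h4⟩

lemma exists_mem_polyline_dist_le {q : ℕ → EuclideanSpace ℝ (Fin d)} {N : ℕ} {ε : ℝ}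
    (hstep : ∀ k < N, ‖q (k + 1) - q k‖ ≤ ε) (hε : 0 ≤ ε) (hN : 0 < N)
    {p : EuclideanSpace ℝ (Fin d)} (hp : p ∈ Polyline q N) : ∃ k < N, dist p (q k) ≤ ε := by
  rcases hp with rfl | hp
  · exact ⟨0, hN, by rwa [dist_self]⟩
  · simp only [mem_iUnion, Finset.mem_range] at hp
    obtain ⟨k, hk, hp⟩ := hp
    refine ⟨k, hk, ?_⟩
    rw [dist_comm, dist_eq_norm]
    refine le_trans ?_ (hstep k hk)
    rw [norm_sub_rev, ← dist_eq_norm, ← dist_eq_norm, dist_comm p, dist_comm (q (k + 1))]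
    linarith [dist_add_dist_of_mem_segment hp, dist_nonneg (x := p) (y := q (k + 1))]

lemma mem_polyline_of_lt {q : ℕ → EuclideanSpace ℝ (Fin d)} {N k : ℕ} (hk : k < N) :
    q k ∈ Polyline q N := by
  refine Or.inr ?_
  simp only [mem_iUnion, Finset.mem_range]
  exact ⟨k, hk, left_mem_segment _ _ _⟩

/-- As `ε → 0`, the polygonal line connecting the points produced by Algorithm 2
started at `x` converges in Hausdorff distance to the gradient ascent line originating at `x`. -/
theorem alg2_polyline_converges (f : EuclideanSpace ℝ (Fin d) → ℝ)
    (hf : StandingAssumptions f) (x xstar : EuclideanSpace ℝ (Fin d))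
    (hmode : IsLocalMax f xstar) (γ : ℝ → EuclideanSpace ℝ (Fin d))
    (hγ : IsGradientFlow f x γ) (hlim : Tendsto γ atTop (nhds xstar)) :
    ∀ δ : ℝ, 0 < δ → ∃ ε₀ > 0, ∀ ε : ℝ, 0 < ε → ε ≤ ε₀ →
      ∀ q K, Alg2Run f x ε q K →
        hausdorffDist (Polyline q (K + 1)) (γ '' Ici 0 ∪ {xstar}) ≤ δ := by

  intro δ hδ
  have hdiff : Differentiable ℝ f := hf.1.differentiable two_ne_zero
  have hcont := hdiff.continuous
  obtain ⟨G, hG⟩ := hf.2.2.1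
  obtain ⟨M, hM, hlip⟩ := hf.exists_lipschitz_gradient
  have hG0 : 0 ≤ G := (norm_nonneg _).trans (hG x)
  have hcrit : gradient f xstar = 0 := by rw [gradient, hmode.fderiv_eq_zero, map_zero]
  have hstrict := hmode.eventually_lt_of_injective_hessian
    (hf.contDiff_gradient.differentiable one_ne_zero xstar) (hf.2.2.2.2.2 xstar hcrit).1
  obtain ⟨r, m, hr, hrδ, hm, hshell⟩ := exists_shell_le hcont hstrict (half_pos hδ)
  obtain ⟨s, hs, hsm⟩ := Metric.eventually_nhds_iff.1
    (hcont.continuousAt.eventually (lt_mem_nhds hm))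
  obtain ⟨ρ, hρ, hρs⟩ := exists_between (lt_min (div_pos hs two_pos) (div_pos hr two_pos))
  rw [lt_min_iff] at hρs
  obtain ⟨T, hT, hnear, c, hc, hspeed⟩ := exists_time_speed_ge hγ.2 hM hlip hlim hρ
  obtain ⟨τ, hτ, hτρ, hMτ⟩ : ∃ τ, 0 < τ ∧ τ ≤ ρ ∧ M * τ ≤ c / 2 := by
    refine ⟨min ρ (c / 2 / (M + 1)), lt_min hρ (by positivity), min_le_left _ _, ?_⟩
    calc M * min ρ (c / 2 / (M + 1)) ≤ (M + 1) * (c / 2 / (M + 1)) := by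
          gcongr
          · linarith
          · exact min_le_right _ _
      _ = c / 2 := by field_simp
  have hsmall : ∀ (F : ℝ → ℝ) (b : ℝ), Continuous F → F 0 < b →
      ∀ᶠ ε in 𝓝[>] (0 : ℝ), F ε < b := fun F b hF h0 =>
    (hF.continuousAt.eventually (gt_mem_nhds h0)).filter_mono nhdsWithin_le_nhds
  have hev : ∀ᶠ ε in 𝓝[>] (0 : ℝ), ε < ρ ∧ 8 * M * ε < c ∧ 2 * ε / c < 1 ∧
      (√(4 * M * G * ε) + M * G * (2 * ε / c)) * (T + 1) * Real.exp (M * (T + 1)) < τ ∧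
      G * (2 * ε / c) < ρ := by
    refine (hsmall _ _ continuous_id hρ).and <| (hsmall _ _ (by fun_prop) (by simpa)).and <|
      (hsmall _ _ (by fun_prop) (by simp)).and <| (hsmall _ _ (by fun_prop) (by simpa)).and <|
      hsmall _ _ (by fun_prop) (by simpa)
  obtain ⟨ε₁, hε₁, hall⟩ := mem_nhdsGT_iff_exists_Ioc_subset.1 hev
  refine ⟨ε₁, hε₁, fun ε hε hεle q K hrun => ?_⟩
  obtain ⟨hερ, hMε, hεc, hητ, hGε⟩ := hall ⟨hε, hεle⟩
  have hstep := fun k hk => (hrun.2.1 k hk).dist_le_and_le hcont hε.le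
  obtain ⟨n, hnK, t, ht0, hTn, hclose, htime⟩ := exists_shadowing_times hdiff hM hlip hG hγ.2 hc hT
    hspeed hε hMτ hMε hεc.le hητ.le (hrun.1.trans hγ.1.symm) hstep hrun.2.2.2
  have hqγ : ∀ k ≤ n, dist (q k) (γ (t k)) ≤ ρ := fun k hk => by
    rw [dist_eq_norm]; exact (hclose k hk).2.trans hτρ
  have hqn : dist (q n) xstar < 2 * ρ := by
    linarith [dist_triangle (q n) (γ (t n)) xstar, hqγ n le_rfl, hnear _ hTn]
  have htail := shell_trap hshell (by linarith : ε ≤ r / 2) (q := q) (n := n) (N := K + 1)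
    (fun k hk => ⟨by rw [dist_eq_norm]; exact (hstep k (by omega)).1,
      (hstep k (by omega)).2 _ (by rw [sub_self, norm_zero]; exact hε.le)⟩)
    (by linarith) (hsm (by linarith))
  have hqn_mem : q n ∈ Polyline q (K + 1) := mem_polyline_of_lt (by omega)
  refine hausdorffDist_le_of_mem_dist hδ.le ?_ ?_
  · intro p hp
    obtain ⟨k, hk, hpk⟩ := exists_mem_polyline_dist_le
      (fun k hk => (hstep k (by omega)).1) hε.le (by omega) hp
    rcases le_total k n with hkn | hkn
    · exact ⟨γ (t k), Or.inl ⟨t k, (hclose k hkn).1, rfl⟩, by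
        linarith [dist_triangle p (q k) (γ (t k)), hqγ k hkn]⟩
    · exact ⟨xstar, Or.inr rfl, by
        linarith [dist_triangle p (q k) xstar, htail k hkn (by omega)]⟩
  · rintro _ (⟨u, hu, rfl⟩ | rfl)
    · rcases lt_or_ge u T with huT | huT
      · have hex : ∃ k, u < t k := ⟨n, huT.trans_le hTn⟩
        classical
        obtain ⟨j, hj⟩ : ∃ j, Nat.find hex = j + 1 := Nat.exists_eq_succ_of_ne_zero fun h => by
          have := Nat.find_spec hex
          rw [h, ht0] at this
          exact this.not_ge hu
        have hjn : j < n := by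
          have := Nat.find_min' hex (huT.trans_le hTn)
          omega
        have htj : t j ≤ u := not_lt.1 (Nat.find_min hex (by omega : j < Nat.find hex))
        have hujs : u < t (j + 1) := hj ▸ Nat.find_spec hex
        refine ⟨q j, mem_polyline_of_lt (by omega), ?_⟩
        have h1 := norm_sub_le_of_bounded_velocity hγ.2 hG (hclose j hjn.le).1 htj
        have h2 : G * (u - t j) ≤ G * (2 * ε / c) := by
          gcongr
          linarith [(htime j hjn).2]
        rw [← dist_eq_norm] at h1
        have h3 := hqγ j hjn.le
        rw [dist_comm] at h3
        linarith [dist_triangle (γ u) (γ (t j)) (q j)]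
      · refine ⟨q n, hqn_mem, ?_⟩
        rw [dist_comm] at hqn
        linarith [dist_triangle (γ u) xstar (q n), hnear u huT]
    · refine ⟨q n, hqn_mem, ?_⟩
      rw [dist_comm]
      linarith
end
end
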